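/- arXiv:1411.4611 — 3 statements merged into one kernel-verified Lean document; each statement's English description precedes it below -/
import Mathlib

section
/- Let W be a regular multiplicative unitary on a complex Hilbert space H and define Δ̂ᵒᵖ(a) := W*(1 ⊗ a)W for a ∈ Â(W). Then the Podleś conditions hold: [Δ̂ᵒᵖ(a)·(b ⊗ 1) : a, b ∈ Â(W)] = Â(W) ⊗min Â(W) and [Δ̂ᵒᵖ(a)·(1 ⊗ b) : a, b ∈ Â(W)] = Â(W) ⊗min Â(W). In particular Δ̂ᵒᵖ maps Â(W) into the multipliers of Â(W) ⊗min Â(W), making (Â(W), Δ̂ᵒᵖ) a bi-simplifiable C*-bialgebra. -/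
/-!
Common framework: we axiomatize realizations of Hilbert-space tensor products.
A `TensorPair E F EF` realizes the Hilbert tensor product `E ⊗ F` as the Hilbert
space `EF`: it consists of a bilinear map `(a, b) ↦ a ⊗ b` whose image satisfies
the characteristic inner-product identity and has total (dense) linear span.
Operators such as the leg operators `X₁₂`, `X₂₃`, `X₁₃`, amplifications `a ⊗ b`,
and the tensor flip `Σ` are then uniquely characterized by their matrix
coefficients against elementary tensors.
-/

noncomputable section

open scoped InnerProductSpace
open ContinuousLinearMap

/-- A realization of the Hilbert tensor product `E ⊗ F` as the Hilbert space `EF`. -/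
structure TensorPair (E F EF : Type*)
    [NormedAddCommGroup E] [InnerProductSpace ℂ E]
    [NormedAddCommGroup F] [InnerProductSpace ℂ F]
    [NormedAddCommGroup EF] [InnerProductSpace ℂ EF] where
  tmul : E →ₗ[ℂ] F →ₗ[ℂ] EF
  inner_tmul : ∀ (a c : E) (b d : F), ⟪tmul a b, tmul c d⟫_ℂ = ⟪a, c⟫_ℂ * ⟪b, d⟫_ℂ
  dense_span : Dense (Submodule.span ℂ {z : EF | ∃ a b, z = tmul a b} : Set EF)

/-- A realization of the threefold Hilbert tensor product `E ⊗ F ⊗ G` as `EFG`. -/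
structure TensorTriple (E F G EFG : Type*)
    [NormedAddCommGroup E] [InnerProductSpace ℂ E]
    [NormedAddCommGroup F] [InnerProductSpace ℂ F]
    [NormedAddCommGroup G] [InnerProductSpace ℂ G]
    [NormedAddCommGroup EFG] [InnerProductSpace ℂ EFG] where
  tmul : E →ₗ[ℂ] F →ₗ[ℂ] G →ₗ[ℂ] EFG
  inner_tmul : ∀ (a a' : E) (b b' : F) (c c' : G),
    ⟪tmul a b c, tmul a' b' c'⟫_ℂ = ⟪a, a'⟫_ℂ * ⟪b, b'⟫_ℂ * ⟪c, c'⟫_ℂ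
  dense_span : Dense (Submodule.span ℂ {z : EFG | ∃ a b c, z = tmul a b c} : Set EFG)

/-- The norm-closed linear span `[S]` of a set of vectors/operators. -/
def cspan {V : Type*} [NormedAddCommGroup V] [NormedSpace ℂ V] (S : Set V) : Set V :=
  closure (Submodule.span ℂ S : Set V)

/-- The set of right-leg slices `(id ⊗ ω_{ξ,η})(X)` of an operator
`X : M₁ ⊗ K₁ → M₂ ⊗ K₂`, i.e. all operators `T : M₁ → M₂` such that
`⟪ζ, T ζ'⟫ = ⟪ζ ⊗ ξ, X (ζ' ⊗ η)⟫` for some `ξ ∈ K₂`, `η ∈ K₁`. -/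
def slicesR {M₁ K₁ M₂ K₂ Ha Hb : Type*}
    [NormedAddCommGroup M₁] [InnerProductSpace ℂ M₁]
    [NormedAddCommGroup K₁] [InnerProductSpace ℂ K₁]
    [NormedAddCommGroup M₂] [InnerProductSpace ℂ M₂]
    [NormedAddCommGroup K₂] [InnerProductSpace ℂ K₂]
    [NormedAddCommGroup Ha] [InnerProductSpace ℂ Ha]
    [NormedAddCommGroup Hb] [InnerProductSpace ℂ Hb]
    (ta : TensorPair M₁ K₁ Ha) (tb : TensorPair M₂ K₂ Hb)
    (X : Ha →L[ℂ] Hb) : Set (M₁ →L[ℂ] M₂) :=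
  {T | ∃ (ξ : K₂) (η : K₁), ∀ (ζ : M₂) (ζ' : M₁),
    ⟪ζ, T ζ'⟫_ℂ = ⟪tb.tmul ζ ξ, X (ta.tmul ζ' η)⟫_ℂ}

/-- The set of left-leg slices `(ω_{ξ,η} ⊗ id)(X)` of an operator
`X : K₁ ⊗ M₁ → K₂ ⊗ M₂`, i.e. all operators `T : M₁ → M₂` such that
`⟪ζ, T ζ'⟫ = ⟪ξ ⊗ ζ, X (η ⊗ ζ')⟫` for some `ξ ∈ K₂`, `η ∈ K₁`. -/
def slicesL {M₁ K₁ M₂ K₂ Ha Hb : Type*}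
    [NormedAddCommGroup M₁] [InnerProductSpace ℂ M₁]
    [NormedAddCommGroup K₁] [InnerProductSpace ℂ K₁]
    [NormedAddCommGroup M₂] [InnerProductSpace ℂ M₂]
    [NormedAddCommGroup K₂] [InnerProductSpace ℂ K₂]
    [NormedAddCommGroup Ha] [InnerProductSpace ℂ Ha]
    [NormedAddCommGroup Hb] [InnerProductSpace ℂ Hb]
    (ta : TensorPair K₁ M₁ Ha) (tb : TensorPair K₂ M₂ Hb)
    (X : Ha →L[ℂ] Hb) : Set (M₁ →L[ℂ] M₂) :=
  {T | ∃ (ξ : K₂) (η : K₁), ∀ (ζ : M₂) (ζ' : M₁),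
    ⟪ζ, T ζ'⟫_ℂ = ⟪tb.tmul ξ ζ, X (ta.tmul η ζ')⟫_ℂ}

/-- `Â(X) := [(id ⊗ ω_{ξ,η})(X) : ξ, η ∈ H] ⊆ B(H)` for `X ∈ B(H ⊗ H)`. -/
def hatA {H H2 : Type*}
    [NormedAddCommGroup H] [InnerProductSpace ℂ H]
    [NormedAddCommGroup H2] [InnerProductSpace ℂ H2]
    (t2 : TensorPair H H H2) (X : H2 →L[ℂ] H2) : Set (H →L[ℂ] H) :=
  cspan (slicesR t2 t2 X)

/-- `A(X) := [(ω_{ξ,η} ⊗ id)(X) : ξ, η ∈ H] ⊆ B(H)` for `X ∈ B(H ⊗ H)`. -/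
def legA {H H2 : Type*}
    [NormedAddCommGroup H] [InnerProductSpace ℂ H]
    [NormedAddCommGroup H2] [InnerProductSpace ℂ H2]
    (t2 : TensorPair H H H2) (X : H2 →L[ℂ] H2) : Set (H →L[ℂ] H) :=
  cspan (slicesL t2 t2 X)

/-- `T` is the tensor-product operator `a ⊗ b : E ⊗ F → E' ⊗ F'`, characterized by its
matrix coefficients against elementary tensors.  In particular `IsTensorOp ta tb a 1 T`
says that `T = a ⊗ 1`, and `IsTensorOp ta tb 1 b T` that `T = 1 ⊗ b`. -/
def IsTensorOp {E F EF E' F' EF' : Type*}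
    [NormedAddCommGroup E] [InnerProductSpace ℂ E]
    [NormedAddCommGroup F] [InnerProductSpace ℂ F]
    [NormedAddCommGroup EF] [InnerProductSpace ℂ EF]
    [NormedAddCommGroup E'] [InnerProductSpace ℂ E']
    [NormedAddCommGroup F'] [InnerProductSpace ℂ F']
    [NormedAddCommGroup EF'] [InnerProductSpace ℂ EF']
    (ta : TensorPair E F EF) (tb : TensorPair E' F' EF')
    (a : E →L[ℂ] E') (b : F →L[ℂ] F') (T : EF →L[ℂ] EF') : Prop :=
  ∀ (ζ : E') (ξ : F') (ζ' : E) (η : F),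
    ⟪tb.tmul ζ ξ, T (ta.tmul ζ' η)⟫_ℂ = ⟪ζ, a ζ'⟫_ℂ * ⟪ξ, b η⟫_ℂ

/-- `A ⊗min B := [(a ⊗ 1)(1 ⊗ b) : a ∈ A, b ∈ B] = [a ⊗ b : a ∈ A, b ∈ B]`. -/
def minTensor {E F EF : Type*}
    [NormedAddCommGroup E] [InnerProductSpace ℂ E]
    [NormedAddCommGroup F] [InnerProductSpace ℂ F]
    [NormedAddCommGroup EF] [InnerProductSpace ℂ EF]
    (t : TensorPair E F EF)
    (A : Set (E →L[ℂ] E)) (B : Set (F →L[ℂ] F)) : Set (EF →L[ℂ] EF) :=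
  cspan {T | ∃ a ∈ A, ∃ b ∈ B, IsTensorOp t t a b T}

/-- `Y = X₁₂ = X ⊗ 1` on `E ⊗ F ⊗ G`, for `X ∈ B(E ⊗ F)`. -/
def IsLeg12 {E F G EF EFG : Type*}
    [NormedAddCommGroup E] [InnerProductSpace ℂ E]
    [NormedAddCommGroup F] [InnerProductSpace ℂ F]
    [NormedAddCommGroup G] [InnerProductSpace ℂ G]
    [NormedAddCommGroup EF] [InnerProductSpace ℂ EF]
    [NormedAddCommGroup EFG] [InnerProductSpace ℂ EFG]
    (t2 : TensorPair E F EF) (t3 : TensorTriple E F G EFG)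
    (X : EF →L[ℂ] EF) (Y : EFG →L[ℂ] EFG) : Prop :=
  ∀ (a a' : E) (b b' : F) (c c' : G),
    ⟪t3.tmul a b c, Y (t3.tmul a' b' c')⟫_ℂ
      = ⟪t2.tmul a b, X (t2.tmul a' b')⟫_ℂ * ⟪c, c'⟫_ℂ

/-- `Y = X₂₃ = 1 ⊗ X` on `E ⊗ F ⊗ G`, for `X ∈ B(F ⊗ G)`. -/
def IsLeg23 {E F G FG EFG : Type*}
    [NormedAddCommGroup E] [InnerProductSpace ℂ E]
    [NormedAddCommGroup F] [InnerProductSpace ℂ F]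
    [NormedAddCommGroup G] [InnerProductSpace ℂ G]
    [NormedAddCommGroup FG] [InnerProductSpace ℂ FG]
    [NormedAddCommGroup EFG] [InnerProductSpace ℂ EFG]
    (t2 : TensorPair F G FG) (t3 : TensorTriple E F G EFG)
    (X : FG →L[ℂ] FG) (Y : EFG →L[ℂ] EFG) : Prop :=
  ∀ (a a' : E) (b b' : F) (c c' : G),
    ⟪t3.tmul a b c, Y (t3.tmul a' b' c')⟫_ℂ
      = ⟪t2.tmul b c, X (t2.tmul b' c')⟫_ℂ * ⟪a, a'⟫_ℂ

/-- `Y = X₁₃ = Σ₁₂X₂₃Σ₁₂` on `E ⊗ F ⊗ G`, for `X ∈ B(E ⊗ G)`: `X` acting on the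
first and third legs. -/
def IsLeg13 {E F G EG EFG : Type*}
    [NormedAddCommGroup E] [InnerProductSpace ℂ E]
    [NormedAddCommGroup F] [InnerProductSpace ℂ F]
    [NormedAddCommGroup G] [InnerProductSpace ℂ G]
    [NormedAddCommGroup EG] [InnerProductSpace ℂ EG]
    [NormedAddCommGroup EFG] [InnerProductSpace ℂ EFG]
    (t2 : TensorPair E G EG) (t3 : TensorTriple E F G EFG)
    (X : EG →L[ℂ] EG) (Y : EFG →L[ℂ] EFG) : Prop :=
  ∀ (a a' : E) (b b' : F) (c c' : G),
    ⟪t3.tmul a b c, Y (t3.tmul a' b' c')⟫_ℂ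
      = ⟪t2.tmul a c, X (t2.tmul a' c')⟫_ℂ * ⟪b, b'⟫_ℂ

/-! ## Infrastructure for tensor pairs -/

namespace TensorPair

section basic
variable {E F EF E' EF' E'' EF'' : Type*}
    [NormedAddCommGroup E] [InnerProductSpace ℂ E]
    [NormedAddCommGroup F] [InnerProductSpace ℂ F]
    [NormedAddCommGroup EF] [InnerProductSpace ℂ EF]
    [NormedAddCommGroup E'] [InnerProductSpace ℂ E']
    [NormedAddCommGroup EF'] [InnerProductSpace ℂ EF']
    [NormedAddCommGroup E''] [InnerProductSpace ℂ E'']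
    [NormedAddCommGroup EF''] [InnerProductSpace ℂ EF'']

theorem norm_tmul (t : TensorPair E F EF) (a : E) (b : F) :
    ‖t.tmul a b‖ = ‖a‖ * ‖b‖ := by
  have h := t.inner_tmul a a b b
  rw [inner_self_eq_norm_sq_to_K, inner_self_eq_norm_sq_to_K, inner_self_eq_norm_sq_to_K] at h
  have h2 : ‖t.tmul a b‖ ^ 2 = (‖a‖ * ‖b‖) ^ 2 := by
    rw [mul_pow]; exact_mod_cast h
  exact (sq_eq_sq₀ (norm_nonneg _) (by positivity)).1 h2

/-- `a ↦ (b ↦ a ⊗ b)`, bounded. -/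
def ketL (t : TensorPair E F EF) : E →L[ℂ] F →L[ℂ] EF :=
  t.tmul.mkContinuous₂ 1 (fun a b => by rw [t.norm_tmul]; simp)

/-- `b ↦ (a ↦ a ⊗ b)`, bounded. -/
def ketR (t : TensorPair E F EF) : F →L[ℂ] E →L[ℂ] EF := t.ketL.flip

@[simp] theorem ketL_apply (t : TensorPair E F EF) (a : E) (b : F) :
    t.ketL a b = t.tmul a b := rfl
@[simp] theorem ketR_apply (t : TensorPair E F EF) (a : E) (b : F) :
    t.ketR b a = t.tmul a b := rfl

/-- The flipped tensor pair. -/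
def swap (t : TensorPair E F EF) : TensorPair F E EF where
  tmul := t.tmul.flip
  inner_tmul a c b d := by simp [t.inner_tmul, mul_comm]
  dense_span := by
    convert t.dense_span using 6 with z
    simp only [LinearMap.flip_apply]
    exact exists_comm

@[simp] theorem swap_tmul (t : TensorPair E F EF) (a : E) (b : F) :
    t.swap.tmul b a = t.tmul a b := rfl

/-- Induction principle: a continuous scalar-compatible additive map sends everything into a
closed submodule as soon as it does so on elementary tensors. -/
theorem mem_of_tmul (t : TensorPair E F EF) {V : Type*} [NormedAddCommGroup V] [NormedSpace ℂ V]
    (P : Submodule ℂ V) (hP : IsClosed (P : Set V)) (f : EF → V) (hf : Continuous f)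
    (hadd : ∀ x y, f (x + y) = f x + f y) (hsmul : ∀ (c : ℂ) x, ∃ c' : ℂ, f (c • x) = c' • f x)
    (h : ∀ a b, f (t.tmul a b) ∈ P) (x : EF) : f x ∈ P := by
  have hcl : IsClosed {x | f x ∈ P} := hP.preimage hf
  have : closure (Submodule.span ℂ {z : EF | ∃ a b, z = t.tmul a b} : Set EF) ⊆ {x | f x ∈ P} := by
    apply closure_minimal _ hcl
    intro z hz
    rw [SetLike.mem_coe] at hz
    induction hz using Submodule.span_induction with
    | mem z hz => obtain ⟨a, b, rfl⟩ := hz; exact h a b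
    | zero =>
      have h0 : f 0 = 0 := by
        have := hadd 0 0
        simpa using this
      simp [h0]
    | add x y hx hy h1 h2 =>
      simp only [Set.mem_ofPred_eq, hadd]
      exact P.add_mem h1 h2
    | smul c x hx h1 =>
      obtain ⟨c', hc'⟩ := hsmul c x
      simp only [Set.mem_ofPred_eq, hc']
      exact P.smul_mem _ h1
  exact this (by rw [t.dense_span.closure_eq]; trivial)

theorem ext_clm (t : TensorPair E F EF) {V : Type*} [NormedAddCommGroup V] [NormedSpace ℂ V]
    {S T : EF →L[ℂ] V} (h : ∀ a b, S (t.tmul a b) = T (t.tmul a b)) : S = T := by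
  ext x
  have := t.mem_of_tmul (⊥ : Submodule ℂ V) (by simp) (fun x => S x - T x) (by fun_prop)
    (fun x y => by simp; abel) (fun c x => ⟨c, by simp [smul_sub]⟩) (fun a b => by simp [h]) x
  simpa [sub_eq_zero] using this

theorem ext_vec (t : TensorPair E F EF) {x y : EF}
    (h : ∀ a b, ⟪t.tmul a b, x⟫_ℂ = ⟪t.tmul a b, y⟫_ℂ) : x = y := by
  apply ext_inner_left ℂ
  intro v
  have := t.mem_of_tmul (⊥ : Submodule ℂ ℂ) (by simp) (fun v => ⟪v, x⟫_ℂ - ⟪v, y⟫_ℂ) (by fun_prop)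
    (fun x y => by simp [inner_add_left]; ring)
    (fun c x => ⟨(starRingEnd ℂ) c, by rw [inner_smul_left, inner_smul_left, smul_eq_mul, mul_sub]⟩) (fun a b => by simp [h]) v
  simpa [sub_eq_zero] using this

theorem ext_op (t : TensorPair E F EF) (t' : TensorPair E' F EF') {S T : EF →L[ℂ] EF'}
    (h : ∀ a b c d, ⟪t'.tmul c d, S (t.tmul a b)⟫_ℂ = ⟪t'.tmul c d, T (t.tmul a b)⟫_ℂ) :
    S = T :=
  t.ext_clm fun a b => t'.ext_vec fun c d => h a b c d

/-- The map from the algebraic tensor product. -/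
def alg (t : TensorPair E F EF) : TensorProduct ℂ E F →ₗ[ℂ] EF := TensorProduct.lift t.tmul

@[simp] theorem alg_tmul (t : TensorPair E F EF) (a : E) (b : F) :
    t.alg (TensorProduct.tmul ℂ a b) = t.tmul a b := by simp [alg]

theorem alg_dense (t : TensorPair E F EF) : DenseRange t.alg := by
  have : Submodule.span ℂ {z : EF | ∃ a b, z = t.tmul a b} ≤ LinearMap.range t.alg := by
    rw [Submodule.span_le]
    rintro _ ⟨a, b, rfl⟩
    exact ⟨TensorProduct.tmul ℂ a b, by simp⟩
  exact t.dense_span.mono this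

theorem exists_contraction [CompleteSpace E] [CompleteSpace E'] (T : E →L[ℂ] E') :
    ∃ c : E →L[ℂ] E, ∀ x y, ⟪c x, c y⟫_ℂ + ⟪T x, T y⟫_ℂ = (‖T‖ : ℂ) ^ 2 * ⟪x, y⟫_ℂ := by
  set A : E →L[ℂ] E := ((‖T‖ : ℂ) ^ 2) • 1 - (adjoint T) ∘L T with hA
  have hpos : 0 ≤ A := by
    rw [ContinuousLinearMap.nonneg_iff_isPositive, ContinuousLinearMap.isPositive_iff_complex]
    intro x
    have h1 : ⟪A x, x⟫_ℂ = ((‖T‖ ^ 2 * ‖x‖ ^ 2 - ‖T x‖ ^ 2 : ℝ) : ℂ) := by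
      simp only [hA, sub_apply, smul_apply, one_apply, comp_apply, inner_sub_left, inner_smul_left,
        adjoint_inner_left, inner_self_eq_norm_sq_to_K]
      simp
    rw [h1]
    refine ⟨by rw [RCLike.re_to_complex, Complex.ofReal_re], ?_⟩
    have h2 := T.le_opNorm x
    have h3 : ‖T x‖ ^ 2 ≤ (‖T‖ * ‖x‖) ^ 2 := by gcongr
    simp only [RCLike.re_to_complex, Complex.ofReal_re]
    nlinarith
  obtain ⟨c, hc⟩ := CStarAlgebra.nonneg_iff_eq_star_mul_self.1 hpos
  refine ⟨c, fun x y => ?_⟩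
  have h1 : ⟪c x, c y⟫_ℂ = ⟪x, A y⟫_ℂ := by
    rw [hc, star_eq_adjoint, ContinuousLinearMap.mul_def, comp_apply, adjoint_inner_right]
  rw [h1]
  simp [hA, inner_sub_right, inner_smul_right, adjoint_inner_right]

theorem alg_bound [CompleteSpace E] [CompleteSpace E'] (t : TensorPair E F EF)
    (t' : TensorPair E' F EF') (T : E →L[ℂ] E') (z : TensorProduct ℂ E F) :
    ‖t'.alg (TensorProduct.map T.toLinearMap LinearMap.id z)‖ ≤ ‖T‖ * ‖t.alg z‖ := by
  obtain ⟨c, hc⟩ := exists_contraction T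
  have key : ∀ z w : TensorProduct ℂ E F,
      ⟪t.alg (TensorProduct.map c.toLinearMap LinearMap.id z),
        t.alg (TensorProduct.map c.toLinearMap LinearMap.id w)⟫_ℂ +
      ⟪t'.alg (TensorProduct.map T.toLinearMap LinearMap.id z),
        t'.alg (TensorProduct.map T.toLinearMap LinearMap.id w)⟫_ℂ =
      (‖T‖ : ℂ) ^ 2 * ⟪t.alg z, t.alg w⟫_ℂ := by
    intro z w
    induction z using TensorProduct.induction_on with
    | zero => simp
    | add z1 z2 h1 h2 =>
      simp only [map_add, inner_add_left, mul_add, ← h1, ← h2]; ring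
    | tmul a b =>
      induction w using TensorProduct.induction_on with
      | zero => simp
      | add z1 z2 h1 h2 =>
        simp only [map_add, inner_add_right, mul_add, ← h1, ← h2]; ring
      | tmul a' b' =>
        simp only [TensorProduct.map_tmul, alg_tmul, inner_tmul, coe_coe, LinearMap.id_apply]
        rw [← add_mul, hc, mul_assoc]
  have h := key z z
  rw [inner_self_eq_norm_sq_to_K, inner_self_eq_norm_sq_to_K, inner_self_eq_norm_sq_to_K] at h
  have h : _ ^ 2 + _ ^ 2 = ‖T‖ ^ 2 * ‖t.alg z‖ ^ 2 := RCLike.ofReal_injective (K := ℂ) (by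
    push_cast; exact h)
  apply le_of_sq_le_sq _ (by positivity)
  rw [mul_pow, ← h]
  nlinarith [sq_nonneg ‖t.alg (TensorProduct.map c.toLinearMap LinearMap.id z)‖]

variable [CompleteSpace E] [CompleteSpace E'] [CompleteSpace E''] [CompleteSpace EF]
  [CompleteSpace EF'] [CompleteSpace EF'']

/-- The amplification `T ⊗ 1`. -/
def amp (t : TensorPair E F EF) (t' : TensorPair E' F EF') :
    (E →L[ℂ] E') →L[ℂ] (EF →L[ℂ] EF') :=
  LinearMap.mkContinuous
    { toFun := fun T =>
        (t'.alg ∘ₗ TensorProduct.map T.toLinearMap LinearMap.id).extendOfNorm t.alg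
      map_add' := fun S T => t.ext_clm fun a b => by
        rw [← alg_tmul, add_apply, LinearMap.extendOfNorm_eq t.alg_dense ⟨_, alg_bound t t' _⟩,
          LinearMap.extendOfNorm_eq t.alg_dense ⟨_, alg_bound t t' _⟩,
          LinearMap.extendOfNorm_eq t.alg_dense ⟨_, alg_bound t t' _⟩]
        simp
      map_smul' := fun c T => t.ext_clm fun a b => by
        rw [← alg_tmul, smul_apply, LinearMap.extendOfNorm_eq t.alg_dense ⟨_, alg_bound t t' _⟩,
          LinearMap.extendOfNorm_eq t.alg_dense ⟨_, alg_bound t t' _⟩]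
        simp } 1 (fun T => by
          rw [one_mul]
          exact LinearMap.opNorm_extendOfNorm_le t.alg_dense (norm_nonneg _) (alg_bound t t' T))

@[simp] theorem amp_tmul (t : TensorPair E F EF) (t' : TensorPair E' F EF') (T : E →L[ℂ] E')
    (a : E) (b : F) : t.amp t' T (t.tmul a b) = t'.tmul (T a) b := by
  conv_lhs => rw [← alg_tmul]
  exact (LinearMap.extendOfNorm_eq t.alg_dense ⟨_, alg_bound t t' _⟩ _).trans (by simp)

theorem amp_comp (t : TensorPair E F EF) (t' : TensorPair E' F EF') (t'' : TensorPair E'' F EF'')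
    (S : E' →L[ℂ] E'') (T : E →L[ℂ] E') :
    t'.amp t'' S ∘L t.amp t' T = t.amp t'' (S ∘L T) :=
  t.ext_clm fun a b => by simp

theorem adjoint_amp (t : TensorPair E F EF) (t' : TensorPair E' F EF') (T : E →L[ℂ] E') :
    adjoint (t.amp t' T) = t'.amp t (adjoint T) :=
  ext_op t' t fun a b c d => by
    simp [adjoint_inner_right, inner_tmul]

theorem amp_ketR (t : TensorPair E F EF) (t' : TensorPair E' F EF') (T : E →L[ℂ] E') (b : F) :
    t.amp t' T ∘L t.ketR b = t'.ketR b ∘L T := by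
  ext a; simp

theorem bra_amp (t : TensorPair E F EF) (t' : TensorPair E' F EF') (T : E →L[ℂ] E') (b : F) :
    adjoint (t'.ketR b) ∘L t.amp t' T = T ∘L adjoint (t.ketR b) := by
  have := congrArg adjoint (amp_ketR t' t (adjoint T) b)
  simpa [adjoint_comp, adjoint_amp] using this

theorem bra_tmul (t : TensorPair E F EF) (a : E) (b c : F) :
    adjoint (t.ketR c) (t.tmul a b) = ⟪c, b⟫_ℂ • a := by
  apply ext_inner_left ℂ
  intro v
  simp [adjoint_inner_right, inner_tmul, inner_smul_right, mul_comm]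

end basic

end TensorPair
/-! ## Tensor triples as iterated tensor pairs -/

namespace TensorTriple

section
variable {E F G EF EFG : Type*}
    [NormedAddCommGroup E] [InnerProductSpace ℂ E]
    [NormedAddCommGroup F] [InnerProductSpace ℂ F]
    [NormedAddCommGroup G] [InnerProductSpace ℂ G]
    [NormedAddCommGroup EF] [InnerProductSpace ℂ EF]
    [NormedAddCommGroup EFG] [InnerProductSpace ℂ EFG]

/-- Exchange legs 2 and 3. -/
def perm (t3 : TensorTriple E F G EFG) : TensorTriple E G F EFG where
  tmul :=
    { toFun := fun a => (t3.tmul a).flip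
      map_add' := fun a b => by ext; simp
      map_smul' := fun c a => by ext; simp }
  inner_tmul a a' b b' c c' := by simp [t3.inner_tmul]; ring
  dense_span := by
    convert t3.dense_span using 5 with z
    simp only [LinearMap.coe_mk, AddHom.coe_mk, LinearMap.flip_apply]
    constructor
    · rintro ⟨a, b, c, h⟩; exact ⟨a, c, b, h⟩
    · rintro ⟨a, b, c, h⟩; exact ⟨a, c, b, h⟩

@[simp] theorem perm_tmul (t3 : TensorTriple E F G EFG) (a : E) (b : F) (c : G) :
    t3.perm.tmul a c b = t3.tmul a b c := rfl

/-- Exchange legs 1 and 2. -/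
def perm' (t3 : TensorTriple E F G EFG) : TensorTriple F E G EFG where
  tmul := t3.tmul.flip
  inner_tmul a a' b b' c c' := by
    rw [LinearMap.flip_apply, LinearMap.flip_apply, t3.inner_tmul]; ring
  dense_span := by
    convert t3.dense_span using 5 with z
    simp only [LinearMap.flip_apply]
    constructor
    · rintro ⟨a, b, c, h⟩; exact ⟨b, a, c, h⟩
    · rintro ⟨a, b, c, h⟩; exact ⟨b, a, c, h⟩

@[simp] theorem perm'_tmul (t3 : TensorTriple E F G EFG) (a : E) (b : F) (c : G) :
    t3.perm'.tmul b a c = t3.tmul a b c := rfl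

/-- The algebraic map `a ⊗ b ↦ a ⊗ b ⊗ c`. -/
def algc (t3 : TensorTriple E F G EFG) (c : G) : TensorProduct ℂ E F →ₗ[ℂ] EFG :=
  TensorProduct.lift (LinearMap.mk₂ ℂ (fun a b => t3.tmul a b c) (by simp) (by simp) (by simp)
    (by simp))

@[simp] theorem algc_tmul (t3 : TensorTriple E F G EFG) (a : E) (b : F) (c : G) :
    t3.algc c (TensorProduct.tmul ℂ a b) = t3.tmul a b c := by simp [algc]

theorem inner_algc (t2 : TensorPair E F EF) (t3 : TensorTriple E F G EFG) (c c' : G)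
    (z w : TensorProduct ℂ E F) :
    ⟪t3.algc c z, t3.algc c' w⟫_ℂ = ⟪t2.alg z, t2.alg w⟫_ℂ * ⟪c, c'⟫_ℂ := by
  induction z using TensorProduct.induction_on with
  | zero => simp
  | add z1 z2 h1 h2 => simp only [map_add, inner_add_left, h1, h2]; ring
  | tmul a b =>
    induction w using TensorProduct.induction_on with
    | zero => simp
    | add z1 z2 h1 h2 => simp only [map_add, inner_add_right, h1, h2]; ring
    | tmul a' b' => simp [t3.inner_tmul, t2.inner_tmul]

theorem algc_bound (t2 : TensorPair E F EF) (t3 : TensorTriple E F G EFG) (c : G)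
    (z : TensorProduct ℂ E F) : ‖t3.algc c z‖ ≤ ‖c‖ * ‖t2.alg z‖ := by
  have h := inner_algc t2 t3 c c z z
  rw [inner_self_eq_norm_sq_to_K, inner_self_eq_norm_sq_to_K, inner_self_eq_norm_sq_to_K] at h
  have h : ‖t3.algc c z‖ ^ 2 = ‖t2.alg z‖ ^ 2 * ‖c‖ ^ 2 := RCLike.ofReal_injective (K := ℂ) (by
    push_cast; exact h)
  apply le_of_sq_le_sq _ (by positivity)
  rw [mul_pow, h, mul_comm]

variable [CompleteSpace EFG]

/-- `x ↦ x ⊗ c`, for `x ∈ E ⊗ F`. -/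
def extc (t2 : TensorPair E F EF) (t3 : TensorTriple E F G EFG) (c : G) : EF →L[ℂ] EFG :=
  (t3.algc c).extendOfNorm t2.alg

theorem extc_alg (t2 : TensorPair E F EF) (t3 : TensorTriple E F G EFG) (c : G)
    (z : TensorProduct ℂ E F) : extc t2 t3 c (t2.alg z) = t3.algc c z :=
  LinearMap.extendOfNorm_eq t2.alg_dense ⟨_, algc_bound t2 t3 c⟩ z

@[simp] theorem extc_tmul (t2 : TensorPair E F EF) (t3 : TensorTriple E F G EFG) (a : E) (b : F)
    (c : G) : extc t2 t3 c (t2.tmul a b) = t3.tmul a b c := by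
  rw [← TensorPair.alg_tmul, extc_alg, algc_tmul]

theorem inner_extc (t2 : TensorPair E F EF) (t3 : TensorTriple E F G EFG) (c c' : G) (x y : EF) :
    ⟪extc t2 t3 c x, extc t2 t3 c' y⟫_ℂ = ⟪x, y⟫_ℂ * ⟪c, c'⟫_ℂ := by
  refine DenseRange.induction_on₂ (e := t2.alg)
    (p := fun x y => ⟪extc t2 t3 c x, extc t2 t3 c' y⟫_ℂ = ⟪x, y⟫_ℂ * ⟪c, c'⟫_ℂ)
    t2.alg_dense (isClosed_eq (by fun_prop) (by fun_prop)) ?_ x y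
  intro z w
  rw [extc_alg, extc_alg, inner_algc t2]

/-- `E ⊗ F ⊗ G = (E ⊗ F) ⊗ G`. -/
def pair (t2 : TensorPair E F EF) (t3 : TensorTriple E F G EFG) : TensorPair EF G EFG where
  tmul := LinearMap.mk₂ ℂ (fun x c => extc t2 t3 c x) (by simp) (by simp)
    (fun x c d => by
      have : extc t2 t3 (c + d) = extc t2 t3 c + extc t2 t3 d := t2.ext_clm fun a b => by simp
      rw [this]; rfl)
    (fun r x c => by
      have : extc t2 t3 (r • c) = r • extc t2 t3 c := t2.ext_clm fun a b => by simp
      rw [this]; rfl)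
  inner_tmul a c b d := by simp [inner_extc]
  dense_span := by
    refine t3.dense_span.mono ?_
    apply Submodule.span_mono
    rintro _ ⟨a, b, c, rfl⟩
    exact ⟨t2.tmul a b, c, by simp⟩

@[simp] theorem pair_tmul (t2 : TensorPair E F EF) (t3 : TensorTriple E F G EFG) (a : E) (b : F)
    (c : G) : (pair t2 t3).tmul (t2.tmul a b) c = t3.tmul a b c := by simp [pair]

end

section
variable {E F G EFG : Type*}
    [NormedAddCommGroup E] [InnerProductSpace ℂ E]
    [NormedAddCommGroup F] [InnerProductSpace ℂ F]
    [NormedAddCommGroup G] [InnerProductSpace ℂ G]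
    [NormedAddCommGroup EFG] [InnerProductSpace ℂ EFG]

theorem mem_of_tmul (t : TensorTriple E F G EFG) {V : Type*} [NormedAddCommGroup V]
    [NormedSpace ℂ V]
    (P : Submodule ℂ V) (hP : IsClosed (P : Set V)) (f : EFG → V) (hf : Continuous f)
    (hadd : ∀ x y, f (x + y) = f x + f y) (hsmul : ∀ (c : ℂ) x, ∃ c' : ℂ, f (c • x) = c' • f x)
    (h : ∀ a b c, f (t.tmul a b c) ∈ P) (x : EFG) : f x ∈ P := by
  have hcl : IsClosed {x | f x ∈ P} := hP.preimage hf
  have : closure (Submodule.span ℂ {z : EFG | ∃ a b c, z = t.tmul a b c} : Set EFG)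
      ⊆ {x | f x ∈ P} := by
    apply closure_minimal _ hcl
    intro z hz
    rw [SetLike.mem_coe] at hz
    induction hz using Submodule.span_induction with
    | mem z hz => obtain ⟨a, b, c, rfl⟩ := hz; exact h a b c
    | zero =>
      have h0 : f 0 = 0 := by
        have := hadd 0 0
        simpa using this
      simp [h0]
    | add x y hx hy h1 h2 =>
      simp only [Set.mem_ofPred_eq, hadd]
      exact P.add_mem h1 h2
    | smul c x hx h1 =>
      obtain ⟨c', hc'⟩ := hsmul c x
      simp only [Set.mem_ofPred_eq, hc']
      exact P.smul_mem _ h1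
  exact this (by rw [t.dense_span.closure_eq]; trivial)

theorem ext_clm (t : TensorTriple E F G EFG) {V : Type*} [NormedAddCommGroup V] [NormedSpace ℂ V]
    {S T : EFG →L[ℂ] V} (h : ∀ a b c, S (t.tmul a b c) = T (t.tmul a b c)) : S = T := by
  ext x
  have := t.mem_of_tmul (⊥ : Submodule ℂ V) (by simp) (fun x => S x - T x) (by fun_prop)
    (fun x y => by simp; abel) (fun c x => ⟨c, by simp [smul_sub]⟩) (fun a b c => by simp [h]) x
  simpa [sub_eq_zero] using this

theorem ext_vec (t : TensorTriple E F G EFG) {x y : EFG}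
    (h : ∀ a b c, ⟪t.tmul a b c, x⟫_ℂ = ⟪t.tmul a b c, y⟫_ℂ) : x = y := by
  apply ext_inner_left ℂ
  intro v
  have := t.mem_of_tmul (⊥ : Submodule ℂ ℂ) (by simp) (fun v => ⟪v, x⟫_ℂ - ⟪v, y⟫_ℂ) (by fun_prop)
    (fun x y => by simp; ring)
    (fun c x => ⟨(starRingEnd ℂ) c, by rw [inner_smul_left, inner_smul_left, smul_eq_mul, mul_sub]⟩)
    (fun a b c => by simp [h]) v
  simpa [sub_eq_zero] using this

theorem ext_op (t : TensorTriple E F G EFG) {S T : EFG →L[ℂ] EFG}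
    (h : ∀ a b c a' b' c', ⟪t.tmul a b c, S (t.tmul a' b' c')⟫_ℂ
      = ⟪t.tmul a b c, T (t.tmul a' b' c')⟫_ℂ) : S = T :=
  t.ext_clm fun _ _ _ => t.ext_vec fun _ _ _ => h _ _ _ _ _ _

end

end TensorTriple

/-! ## Closed spans -/

section closedspan
variable {V V' : Type*} [NormedAddCommGroup V] [NormedSpace ℂ V]
  [NormedAddCommGroup V'] [NormedSpace ℂ V']

/-- The closed linear span as a submodule. -/
def clS (S : Set V) : Submodule ℂ V := (Submodule.span ℂ S).topologicalClosure

theorem coe_clS (S : Set V) : (clS S : Set V) = cspan S := rfl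

theorem isClosed_clS (S : Set V) : IsClosed (clS S : Set V) :=
  Submodule.isClosed_topologicalClosure _

theorem sub_clS {S : Set V} {x : V} (h : x ∈ S) : x ∈ clS S :=
  Submodule.le_topologicalClosure _ (Submodule.subset_span h)

theorem clS_le {S : Set V} {P : Submodule ℂ V} (hP : IsClosed (P : Set V)) (h : ∀ x ∈ S, x ∈ P) :
    clS S ≤ P :=
  Submodule.topologicalClosure_minimal _ (Submodule.span_le.2 h) hP

/-- A continuous, additive, scalar-compatible map sends the closed span of `S` into a closed
submodule as soon as it does so on `S`. -/
theorem clS_map {S : Set V} (P : Submodule ℂ V') (hP : IsClosed (P : Set V'))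
    (f : V → V') (hf : Continuous f)
    (hadd : ∀ x y, f (x + y) = f x + f y) (hsmul : ∀ (c : ℂ) x, ∃ c' : ℂ, f (c • x) = c' • f x)
    (h : ∀ s ∈ S, f s ∈ P) {x : V} (hx : x ∈ clS S) : f x ∈ P := by
  have hcl : IsClosed {x | f x ∈ P} := hP.preimage hf
  have h0 : f 0 = 0 := by
    have := hadd 0 0
    simpa using this
  have : clS S ≤ { carrier := {x | f x ∈ P}
                   add_mem' := fun {a b} ha hb => by
                    simp only [Set.mem_ofPred_eq, hadd] at *
                    exact P.add_mem ha hb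
                   zero_mem' := by simp [h0]
                   smul_mem' := fun c x hx => by
                    obtain ⟨c', hc'⟩ := hsmul c x
                    simp only [Set.mem_ofPred_eq, hc'] at *
                    exact P.smul_mem _ hx : Submodule ℂ V } := clS_le hcl h
  exact this hx

/-- Linear version of `clS_map`. -/
theorem clS_mapL {S : Set V} (P : Submodule ℂ V') (hP : IsClosed (P : Set V'))
    (f : V →L[ℂ] V') (h : ∀ s ∈ S, f s ∈ P) {x : V} (hx : x ∈ clS S) : f x ∈ P :=
  clS_map P hP f f.continuous (by simp) (fun c x => ⟨c, by simp⟩) h hx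

end closedspan

/-! ## Compact operators are limits of finite rank operators -/

section compact
variable {H : Type*} [NormedAddCommGroup H] [InnerProductSpace ℂ H] [CompleteSpace H]

theorem compact_mem_clS (T : H →L[ℂ] H) (hT : IsCompactOperator T) :
    T ∈ clS {k : H →L[ℂ] H | ∃ a b : H, k = InnerProductSpace.rankOne ℂ a b} := by
  have hmem : ∀ ε > 0, ∃ S ∈ Submodule.span ℂ
      {k : H →L[ℂ] H | ∃ a b : H, k = InnerProductSpace.rankOne ℂ a b}, dist T S ≤ ε := by
    intro ε hε
    have hc := hT.isCompact_closure_image_closedBall (f := (T : H →ₗ[ℂ] H)) 1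
    obtain ⟨s, hsf, hs⟩ := Metric.totallyBounded_iff.1 hc.totallyBounded ε hε
    set U : Submodule ℂ H := Submodule.span ℂ s with hU
    have : FiniteDimensional ℂ U := FiniteDimensional.span_of_finite ℂ hsf
    refine ⟨U.starProjection ∘L T, ?_, ?_⟩
    · let b := stdOrthonormalBasis ℂ U
      have hP : U.starProjection = ∑ i, InnerProductSpace.rankOne ℂ (b i : H) (b i : H) := by
        ext x
        simp [Submodule.starProjection_apply, b.orthogonalProjectionOnto_apply_eq_sum]
      rw [hP, finsetSum_comp]
      refine Submodule.sum_mem _ fun i _ => Submodule.subset_span ⟨b i, adjoint T (b i), ?_⟩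
      ext x
      simp [adjoint_inner_left]
    · rw [dist_eq_norm]
      have hball : ∀ x : H, ‖x‖ ≤ 1 → ‖(T - U.starProjection ∘L T) x‖ ≤ ε := by
        intro x hx
        have : T x ∈ closure ((T : H →ₗ[ℂ] H) '' Metric.closedBall 0 1) :=
          subset_closure ⟨x, by simpa using hx, rfl⟩
        obtain ⟨y, hy, hxy⟩ := Set.mem_iUnion₂.1 (hs this)
        have hyU : y ∈ U := Submodule.subset_span hy
        have h1 : ‖T x - U.starProjection (T x)‖ ≤ ‖T x - y‖ := by
          rw [Submodule.starProjection_minimal]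
          exact ciInf_le ⟨0, by rintro _ ⟨_, rfl⟩; positivity⟩ (⟨y, hyU⟩ : U)
        simp only [sub_apply, comp_apply]
        refine h1.trans ?_
        rw [← dist_eq_norm]
        exact (Metric.mem_ball.1 hxy).le
      apply opNorm_le_of_unit_norm hε.le
      intro x hx
      exact hball x hx.le
  show T ∈ closure (_ : Set _)
  rw [Metric.mem_closure_iff]
  intro ε hε
  obtain ⟨S, hS, hd⟩ := hmem (ε / 2) (by positivity)
  exact ⟨S, hS, by linarith⟩

theorem isCompactOperator_rankOne (a b : H) :
    IsCompactOperator (InnerProductSpace.rankOne ℂ a b : H →L[ℂ] H) := by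
  have h : IsCompactOperator (innerSL ℂ b) := isCompactOperator_of_locallyCompactSpace_dom _
  have := h.clm_comp (toSpanSingleton ℂ a)
  exact this
end compact
/-! ## Regular multiplicative unitaries -/

/-- Bundled data of a regular multiplicative unitary (internal to the proof). -/
structure RegMU (H H2 H3 : Type*)
    [NormedAddCommGroup H] [InnerProductSpace ℂ H] [CompleteSpace H]
    [NormedAddCommGroup H2] [InnerProductSpace ℂ H2] [CompleteSpace H2]
    [NormedAddCommGroup H3] [InnerProductSpace ℂ H3] [CompleteSpace H3] where
  t2 : TensorPair H H H2
  t3 : TensorTriple H H H H3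
  W : H2 →L[ℂ] H2
  uni1 : ∀ x, adjoint W (W x) = x
  uni2 : ∀ x, W (adjoint W x) = x
  pent : ∀ x, (TensorTriple.pair t2 t3.perm'.perm).amp (TensorTriple.pair t2 t3.perm'.perm) W
      ((TensorTriple.pair t2 t3).amp (TensorTriple.pair t2 t3) W x) =
    (TensorTriple.pair t2 t3).amp (TensorTriple.pair t2 t3) W
      ((TensorTriple.pair t2 t3.perm).amp (TensorTriple.pair t2 t3.perm) W
        ((TensorTriple.pair t2 t3.perm'.perm).amp (TensorTriple.pair t2 t3.perm'.perm) W x))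
  reg : ∀ k : H →L[ℂ] H, IsCompactOperator k ↔
    k ∈ clS {k : H →L[ℂ] H | ∃ α β, k = adjoint (t2.ketL α) ∘L W ∘L t2.ketR β}

namespace RegMU
variable {H H2 H3 : Type*}
    [NormedAddCommGroup H] [InnerProductSpace ℂ H] [CompleteSpace H]
    [NormedAddCommGroup H2] [InnerProductSpace ℂ H2] [CompleteSpace H2]
    [NormedAddCommGroup H3] [InnerProductSpace ℂ H3] [CompleteSpace H3]
    (M : RegMU H H2 H3)

def P12 : TensorPair H2 H H3 := TensorTriple.pair M.t2 M.t3
def P13 : TensorPair H2 H H3 := TensorTriple.pair M.t2 M.t3.perm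
def P23 : TensorPair H2 H H3 := TensorTriple.pair M.t2 M.t3.perm'.perm

@[simp] theorem P12_tmul (a b c : H) : M.P12.tmul (M.t2.tmul a b) c = M.t3.tmul a b c := by
  simp [P12]
@[simp] theorem P13_tmul (a b c : H) : M.P13.tmul (M.t2.tmul a c) b = M.t3.tmul a b c := by
  simp [P13]
@[simp] theorem P23_tmul (a b c : H) : M.P23.tmul (M.t2.tmul b c) a = M.t3.tmul a b c := by
  simp [P23]

def W12 : H3 →L[ℂ] H3 := M.P12.amp M.P12 M.W
def W13 : H3 →L[ℂ] H3 := M.P13.amp M.P13 M.W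
def W23 : H3 →L[ℂ] H3 := M.P23.amp M.P23 M.W
def R : H →L[ℂ] H →L[ℂ] H2 := M.t2.ketR
def L : H →L[ℂ] H →L[ℂ] H2 := M.t2.ketL
def R12 : H →L[ℂ] H2 →L[ℂ] H3 := M.P12.ketR
def R13 : H →L[ℂ] H2 →L[ℂ] H3 := M.P13.ketR
def K : H2 →L[ℂ] H →L[ℂ] H3 := M.P23.ketL
/-- `a ⊗ 1` -/
def one : (H →L[ℂ] H) →L[ℂ] (H2 →L[ℂ] H2) := M.t2.amp M.t2
/-- `1 ⊗ a` -/
def two : (H →L[ℂ] H) →L[ℂ] (H2 →L[ℂ] H2) := M.t2.swap.amp M.t2.swap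
/-- `1 ⊗ T` for `T : H → H ⊗ H`. -/
def amp23 : (H →L[ℂ] H2) →L[ℂ] (H2 →L[ℂ] H3) := M.t2.swap.amp M.P23
/-- `S` acting on legs 1, 3. -/
def G : (H2 →L[ℂ] H) →L[ℂ] (H3 →L[ℂ] H2) := M.P13.amp M.t2
def rho (ξ η : H) : H →L[ℂ] H := adjoint (M.R ξ) ∘L M.W ∘L M.R η

theorem pentagon (x : H3) : M.W23 (M.W12 x) = M.W12 (M.W13 (M.W23 x)) := M.pent x

section amp_id
theorem amp_unitary {E F EF : Type*}
    [NormedAddCommGroup E] [InnerProductSpace ℂ E] [CompleteSpace E]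
    [NormedAddCommGroup F] [InnerProductSpace ℂ F]
    [NormedAddCommGroup EF] [InnerProductSpace ℂ EF] [CompleteSpace EF]
    (t : TensorPair E F EF) (S T : E →L[ℂ] E) (h : ∀ x, S (T x) = x) (x : EF) :
    t.amp t S (t.amp t T x) = x := by
  have : t.amp t S ∘L t.amp t T = ContinuousLinearMap.id ℂ EF :=
    t.ext_clm fun a b => by simp [h]
  exact (DFunLike.congr_fun this x)
end amp_id

theorem adj_W12 : adjoint M.W12 = M.P12.amp M.P12 (adjoint M.W) := TensorPair.adjoint_amp ..
theorem adj_W23 : adjoint M.W23 = M.P23.amp M.P23 (adjoint M.W) := TensorPair.adjoint_amp ..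

theorem W12_uni1 (x) : adjoint M.W12 (M.W12 x) = x := by
  rw [adj_W12]; exact amp_unitary _ _ _ M.uni1 x
theorem W23_uni1 (x) : adjoint M.W23 (M.W23 x) = x := by
  rw [adj_W23]; exact amp_unitary _ _ _ M.uni1 x
theorem W23_uni2 (x) : M.W23 (adjoint M.W23 x) = x := by
  rw [adj_W23]; exact amp_unitary _ _ _ M.uni2 x

theorem pentA (x : H3) : M.W13 (M.W23 x) = adjoint M.W12 (M.W23 (M.W12 x)) := by
  rw [pentagon, W12_uni1]
theorem pentB (x : H3) : M.W12 (M.W13 x) = M.W23 (M.W12 (adjoint M.W23 x)) := by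
  rw [pentagon, W23_uni2]

theorem K_tmul (a b c : H) : M.K (M.t2.tmul b c) a = M.R12 c (M.R b a) := by
  simp [K, R12, R]
theorem K_tmul' (a b c : H) : M.K (M.t2.tmul b c) a = M.R13 b (M.R c a) := by
  simp [K, R13, R]
theorem K_adj (b c : H) (v : H3) :
    adjoint (M.K (M.t2.tmul b c)) v = adjoint (M.R b) (adjoint (M.R12 c) v) := by
  have : M.K (M.t2.tmul b c) = M.R12 c ∘L M.R b := by ext a; exact M.K_tmul a b c
  rw [this, adjoint_comp]; rfl
theorem K_adj' (b c : H) (v : H3) :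
    adjoint (M.K (M.t2.tmul b c)) v = adjoint (M.R c) (adjoint (M.R13 b) v) := by
  have : M.K (M.t2.tmul b c) = M.R13 b ∘L M.R c := by ext a; exact M.K_tmul' a b c
  rw [this, adjoint_comp]; rfl

theorem W12_R12 (η : H) (v) : M.W12 (M.R12 η v) = M.R12 η (M.W v) :=
  (DFunLike.congr_fun (TensorPair.amp_ketR M.P12 M.P12 M.W η) v)
theorem W12s_R12 (η : H) (v) : adjoint M.W12 (M.R12 η v) = M.R12 η (adjoint M.W v) := by
  rw [adj_W12]; exact (DFunLike.congr_fun (TensorPair.amp_ketR M.P12 M.P12 (adjoint M.W) η) v)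
theorem R12s_W12 (η : H) (v) : adjoint (M.R12 η) (M.W12 v) = M.W (adjoint (M.R12 η) v) :=
  (DFunLike.congr_fun (TensorPair.bra_amp M.P12 M.P12 M.W η) v)
theorem W13_R13 (η : H) (v) : M.W13 (M.R13 η v) = M.R13 η (M.W v) :=
  (DFunLike.congr_fun (TensorPair.amp_ketR M.P13 M.P13 M.W η) v)
theorem R13s_W13 (η : H) (v) : adjoint (M.R13 η) (M.W13 v) = M.W (adjoint (M.R13 η) v) :=
  (DFunLike.congr_fun (TensorPair.bra_amp M.P13 M.P13 M.W η) v)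
theorem W23_K (x : H2) (v) : M.W23 (M.K x v) = M.K (M.W x) v := by simp [W23, K]
theorem W23s_K (x : H2) (v) : adjoint M.W23 (M.K x v) = M.K (adjoint M.W x) v := by
  rw [adj_W23]; simp [K]
theorem Ks_W23 (x : H2) (v) :
    adjoint (M.K x) (M.W23 v) = adjoint (M.K (adjoint M.W x)) v := by
  have h : adjoint M.W23 ∘L M.K x = M.K (adjoint M.W x) := by ext a; exact M.W23s_K x a
  rw [← h, adjoint_comp, adjoint_adjoint]; rfl

theorem X1 (ξ η : H) (v : H2) :
    adjoint (M.R12 ξ) (M.R13 η v) = M.R η (adjoint (M.R ξ) v) := by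
  have : adjoint (M.R12 ξ) ∘L M.R13 η = M.R η ∘L adjoint (M.R ξ) :=
    TensorPair.ext_op M.t2 M.t2 fun a b c d => by
      simp [adjoint_inner_right, R12, R13, R, TensorPair.bra_tmul, TensorPair.inner_tmul,
        TensorTriple.inner_tmul, inner_smul_right]
      try ring
  exact (DFunLike.congr_fun this v)
theorem X2 (ξ η : H) (v : H2) :
    adjoint (M.R13 ξ) (M.R12 η v) = M.R η (adjoint (M.R ξ) v) := by
  have : adjoint (M.R13 ξ) ∘L M.R12 η = M.R η ∘L adjoint (M.R ξ) :=
    TensorPair.ext_op M.t2 M.t2 fun a b c d => by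
      simp [adjoint_inner_right, R12, R13, R, TensorPair.bra_tmul, TensorPair.inner_tmul,
        TensorTriple.inner_tmul, inner_smul_right]
      try ring
  exact (DFunLike.congr_fun this v)
theorem R12s_R12 (ξ η : H) (v : H2) :
    adjoint (M.R12 ξ) (M.R12 η v) = ⟪ξ, η⟫_ℂ • v := TensorPair.bra_tmul _ _ _ _

theorem amp23_R (η : H) : M.amp23 (M.R η) = M.R12 η :=
  M.t2.ext_clm fun a b => by
    rw [amp23, ← TensorPair.swap_tmul, TensorPair.amp_tmul]; simp [R, R12]
theorem amp23_L (η : H) : M.amp23 (M.L η) = M.R13 η :=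
  M.t2.ext_clm fun a b => by
    rw [amp23, ← TensorPair.swap_tmul, TensorPair.amp_tmul]; simp [L, R13]
theorem amp13_R (η : H) : M.t2.amp M.P13 (M.R η) = M.R12 η :=
  M.t2.ext_clm fun a b => by
    rw [TensorPair.amp_tmul]; simp [R, R12]

theorem amp23_comp (X : H2 →L[ℂ] H2) (T : H →L[ℂ] H2) (v : H2) :
    M.amp23 (X ∘L T) v = M.P23.amp M.P23 X (M.amp23 T v) :=
  (DFunLike.congr_fun (TensorPair.amp_comp M.t2.swap M.P23 M.P23 X T) v).symm
theorem amp23_comp_two (T : H →L[ℂ] H2) (b : H →L[ℂ] H) (v : H2) :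
    M.amp23 (T ∘L b) v = M.amp23 T (M.two b v) :=
  (DFunLike.congr_fun (TensorPair.amp_comp M.t2.swap M.t2.swap M.P23 T b) v).symm
theorem amp23_W (η : H) (v : H2) : M.amp23 (M.W ∘L M.R η) v = M.W23 (M.R12 η v) := by
  rw [amp23_comp, amp23_R]; rfl
theorem two_bra (S T : H →L[ℂ] H2) (v : H2) :
    M.two (adjoint S ∘L T) v = adjoint (M.amp23 S) (M.amp23 T v) := by
  rw [amp23, TensorPair.adjoint_amp]
  exact (DFunLike.congr_fun (TensorPair.amp_comp M.t2.swap M.P23 M.t2.swap (adjoint S) T) v).symm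
theorem two_rho (ξ η : H) (v : H2) :
    M.two (M.rho ξ η) v = adjoint (M.R12 ξ) (M.W23 (M.R12 η v)) := by
  rw [rho, two_bra, amp23_R, amp23_W]
theorem two_slice (α β : H) (v : H2) :
    M.two (adjoint (M.L α) ∘L M.W ∘L M.R β) v = adjoint (M.R13 α) (M.W23 (M.R12 β v)) := by
  rw [two_bra, amp23_L, amp23_W]
theorem two_adj (b : H →L[ℂ] H) : M.two (adjoint b) = adjoint (M.two b) :=
  (TensorPair.adjoint_amp _ _ _).symm
theorem one_adj (b : H →L[ℂ] H) : M.one (adjoint b) = adjoint (M.one b) :=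
  (TensorPair.adjoint_amp _ _ _).symm
theorem two_two (a b : H →L[ℂ] H) (v : H2) : M.two a (M.two b v) = M.two (a ∘L b) v :=
  (DFunLike.congr_fun (TensorPair.amp_comp M.t2.swap M.t2.swap M.t2.swap a b) v)
theorem two_tmul (b : H →L[ℂ] H) (x y : H) : M.two b (M.t2.tmul x y) = M.t2.tmul x (b y) := by
  rw [← TensorPair.swap_tmul, two, TensorPair.amp_tmul, TensorPair.swap_tmul]
theorem one_tmul (b : H →L[ℂ] H) (x y : H) : M.one b (M.t2.tmul x y) = M.t2.tmul (b x) y := by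
  rw [one, TensorPair.amp_tmul]
theorem one_two (a b : H →L[ℂ] H) (v : H2) : M.one a (M.two b v) = M.two b (M.one a v) := by
  have : M.one a ∘L M.two b = M.two b ∘L M.one a := M.t2.ext_clm fun x y => by
    simp [one_tmul, two_tmul]
  exact (DFunLike.congr_fun this v)
theorem two_rankOne (a b : H) (v : H2) :
    M.two (InnerProductSpace.rankOne ℂ a b) v = M.R a (adjoint (M.R b) v) := by
  have : M.two (InnerProductSpace.rankOne ℂ a b) = M.R a ∘L adjoint (M.R b) :=
    M.t2.ext_clm fun x y => by
      simp [two_tmul, R, TensorPair.bra_tmul]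
  exact (DFunLike.congr_fun this v)
theorem two_R (b : H →L[ℂ] H) (a v : H) : M.two b (M.R a v) = M.R (b a) v := M.two_tmul _ _ _
theorem one_R (b : H →L[ℂ] H) (a v : H) : M.one b (M.R a v) = M.R a (b v) := M.one_tmul _ _ _
theorem one_rho (ξ η : H) (v : H2) :
    M.one (M.rho ξ η) v = adjoint (M.R12 ξ) (M.W13 (M.R12 η v)) := by
  rw [← amp13_R, ← amp13_R, TensorPair.adjoint_amp, W13, one, rho,
    ← TensorPair.amp_comp M.t2 M.P13 M.t2, ← TensorPair.amp_comp M.t2 M.P13 M.P13]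
  rfl

/-! ### The main identities -/

theorem rho_adj (ξ η ζ : H) :
    adjoint (M.rho ξ η) ζ = adjoint (M.R η) (adjoint M.W (M.R ξ ζ)) := by
  rw [rho, adjoint_comp, adjoint_comp, adjoint_adjoint]; rfl

theorem J1 (ξ η ξ' η' : H) : M.rho ξ η ∘L M.rho ξ' η' =
    adjoint (M.K (adjoint M.W (M.t2.tmul ξ ξ'))) ∘L M.W12 ∘L
      M.K (adjoint M.W (M.t2.tmul η η')) := by
  ext ζ
  simp only [comp_apply, rho]
  rw [← Ks_W23, ← W23s_K, ← pentB, K_tmul', W13_R13, K_adj, R12s_W12, X1]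

theorem KWK (ξ η ξ' η' : H) :
    adjoint (M.K (M.t2.tmul ξ ξ')) ∘L M.W12 ∘L M.K (M.t2.tmul η η') = ⟪ξ', η'⟫_ℂ • M.rho ξ η := by
  ext ζ
  simp only [comp_apply, rho, smul_apply]
  rw [K_adj, R12s_W12, K_tmul, R12s_R12, map_smul, map_smul]

theorem WkW (α β : H) (v : H2) :
    M.W (M.two (adjoint (M.L α) ∘L M.W ∘L M.R β) (adjoint M.W v)) =
      adjoint (M.R13 α) (adjoint M.W12 (M.W23 (M.R12 β v))) := by
  rw [two_slice, ← R13s_W13, pentA, W12_R12, M.uni2]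

theorem Psi_slice (ξ ξ' α β : H) :
    adjoint (M.R ξ) ∘L M.W ∘L M.two (adjoint (M.L α) ∘L M.W ∘L M.R β) ∘L adjoint M.W ∘L M.R ξ' =
    adjoint (M.K (M.t2.tmul α ξ)) ∘L adjoint M.W12 ∘L M.K (M.W (M.t2.tmul ξ' β)) := by
  ext ζ
  simp only [comp_apply]
  rw [← W23_K, K_tmul, K_adj', ← WkW]

theorem Psi_rank (ξ ξ' η η' : H) :
    adjoint (M.R ξ) ∘L M.W ∘L M.two (InnerProductSpace.rankOne ℂ η η') ∘L adjoint M.W ∘L M.R ξ' =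
    M.rho ξ η ∘L adjoint (M.rho ξ' η') := by
  ext ζ
  simp only [comp_apply, two_rankOne, rho_adj]
  rfl

theorem f_rank (η' α ζ : H) :
    M.W ∘L M.two (InnerProductSpace.rankOne ℂ α ζ) ∘L adjoint M.W ∘L M.R η' =
    M.W ∘L M.R α ∘L adjoint (M.rho η' ζ) := by
  ext v
  simp only [comp_apply, two_rankOne, rho_adj]

theorem f_slice (η' α β : H) :
    M.W ∘L M.two (adjoint (M.L α) ∘L M.W ∘L M.R β) ∘L adjoint M.W ∘L M.R η' =
    adjoint (M.R13 α) ∘L adjoint M.W12 ∘L M.K (M.W (M.t2.tmul η' β)) := by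
  ext v
  simp only [comp_apply]
  rw [← W23_K, K_tmul, ← WkW]

theorem f_elem (α η β : H) :
    adjoint (M.R13 α) ∘L adjoint M.W12 ∘L M.K (M.t2.tmul η β) =
      M.R β ∘L adjoint (M.rho η α) := by
  ext v
  simp only [comp_apply]
  rw [K_tmul, W12s_R12, X2, rho_adj]

theorem E_one (η ξ' η' : H) :
    M.W ∘L M.R η ∘L M.rho ξ' η' =
      adjoint (M.R12 ξ') ∘L M.W23 ∘L M.W12 ∘L M.K (adjoint M.W (M.t2.tmul η η')) := by
  ext v
  simp only [comp_apply, rho]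
  rw [← W23s_K, ← pentB, K_tmul', W13_R13, R12s_W12, X1]

theorem E_elem (η ξ' η' : H) :
    adjoint (M.R12 ξ') ∘L M.W23 ∘L M.W12 ∘L M.K (M.t2.tmul η η') =
      M.two (M.rho ξ' η') ∘L M.W ∘L M.R η := by
  ext v
  simp only [comp_apply]
  rw [K_tmul, W12_R12, two_rho]

theorem Delta_rho (ξ η : H) (v : H2) :
    adjoint M.W (M.two (M.rho ξ η) (M.W v)) =
      adjoint (M.R12 ξ) (M.W13 (M.W23 (M.R12 η v))) := by
  have h : adjoint M.W ∘L adjoint (M.R12 ξ) = adjoint (M.R12 ξ) ∘L adjoint M.W12 := by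
    rw [← adjoint_comp, ← adjoint_comp]
    congr 1
    ext x
    exact (M.W12_R12 ξ x).symm
  rw [two_rho, pentA, W12_R12]
  exact (DFunLike.congr_fun h _)

/-- `F ξ T = ⟨ξ|₃ W₁₃ T₂₃`. -/
def F (ξ : H) (T : H →L[ℂ] H2) : H2 →L[ℂ] H2 := adjoint (M.R12 ξ) ∘L M.W13 ∘L M.amp23 T

theorem F_R (ξ η : H) (b : H →L[ℂ] H) :
    M.F ξ (M.R η ∘L b) = M.one (M.rho ξ η) ∘L M.two b := by
  ext v
  simp only [F, comp_apply]
  rw [amp23_comp_two, amp23_R, one_rho]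

theorem F_W (ξ η : H) (b : H →L[ℂ] H) :
    M.F ξ (M.W ∘L M.R η ∘L b) =
      (adjoint M.W ∘L M.two (M.rho ξ η) ∘L M.W) ∘L M.two b := by
  ext v
  simp only [F, comp_apply]
  rw [← ContinuousLinearMap.comp_assoc, amp23_comp_two, amp23_W, Delta_rho]

/-- `Y x = K(x)* W₁₂ W₂₃* |η'⟩` on leg three. -/
def Y (η' : H) (x : H2) : H2 →L[ℂ] H :=
  adjoint (M.K x) ∘L M.W12 ∘L adjoint M.W23 ∘L M.R12 η'

theorem Y_one (ξ ξ' η' : H) :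
    M.Y η' (adjoint M.W (M.t2.tmul ξ ξ')) =
      adjoint (M.R ξ) ∘L M.W ∘L M.one (M.rho ξ' η') := by
  ext v
  simp only [Y, comp_apply]
  rw [← Ks_W23, ← pentB, K_adj, R12s_W12, one_rho]

theorem Y_two (ξ ξ' η' : H) :
    M.Y η' (M.t2.tmul ξ ξ') =
      adjoint (M.R ξ) ∘L M.W ∘L M.two (adjoint (M.rho η' ξ')) := by
  have h : M.two (adjoint (M.rho η' ξ')) =
      adjoint (M.R12 ξ') ∘L adjoint M.W23 ∘L M.R12 η' := by
    have h2 : M.two (M.rho η' ξ') = adjoint (M.R12 η') ∘L M.W23 ∘L M.R12 ξ' := by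
      ext v; exact M.two_rho _ _ _
    rw [two_adj, h2, adjoint_comp, adjoint_comp, adjoint_adjoint, ContinuousLinearMap.comp_assoc]
  ext v
  simp only [Y, h, comp_apply]
  rw [K_adj, R12s_W12]

theorem G_bra (ξ : H) (X : H2 →L[ℂ] H2) (v : H3) :
    M.G (adjoint (M.R ξ) ∘L M.W ∘L X) v =
      adjoint (M.R12 ξ) (M.W13 (M.P13.amp M.P13 X v)) := by
  rw [← amp13_R, TensorPair.adjoint_amp, W13, G,
    ← TensorPair.amp_comp M.P13 M.P13 M.t2, ← TensorPair.amp_comp M.P13 M.P13 M.P13]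
  rfl

theorem leg1_K (b : H →L[ℂ] H) (x : H2) (v : H) :
    M.P13.amp M.P13 (M.one b) (M.K x v) = M.K x (b v) := by
  have : M.P13.amp M.P13 (M.one b) ∘L M.P23.ketR v = M.P23.ketR (b v) :=
    M.t2.ext_clm fun y z => by
      simp only [comp_apply, TensorPair.ketR_apply, P23_tmul]
      rw [← P13_tmul, TensorPair.amp_tmul, one_tmul, P13_tmul]
  exact (DFunLike.congr_fun this x)

theorem G_one (ξ η : H) (b : H →L[ℂ] H) :
    M.G (adjoint (M.R ξ) ∘L M.W ∘L M.one b) ∘L M.W23 ∘L M.R12 η =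
      (adjoint M.W ∘L M.two (M.rho ξ η) ∘L M.W) ∘L M.one b := by
  have h : M.P13.amp M.P13 (M.one b) ∘L M.W23 ∘L M.R12 η = M.W23 ∘L M.R12 η ∘L M.one b :=
    M.t2.ext_clm fun y z => by
      have e : ∀ y, M.R12 η (M.t2.tmul y z) = M.K (M.t2.tmul z η) y := fun y => by
        rw [K_tmul]; rfl
      simp only [comp_apply]
      rw [one_tmul, e, e, W23_K, leg1_K, W23_K]
  ext v
  simp only [comp_apply]
  rw [G_bra, Delta_rho]
  exact congrArg (fun z => adjoint (M.R12 ξ) (M.W13 z)) (DFunLike.congr_fun h v)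

theorem G_two (ξ η : H) (a : H →L[ℂ] H) :
    M.G (adjoint (M.R ξ) ∘L M.W ∘L M.two a) ∘L M.W23 ∘L M.R12 η =
      M.F ξ (M.two a ∘L M.W ∘L M.R η) := by
  have h : M.P13.amp M.P13 (M.two a) = M.P23.amp M.P23 (M.two a) :=
    M.t3.ext_clm fun x y z => by
      conv_lhs => rw [← P13_tmul, TensorPair.amp_tmul, two_tmul, P13_tmul]
      conv_rhs => rw [← P23_tmul, TensorPair.amp_tmul, two_tmul, P23_tmul]
  ext v
  simp only [comp_apply, F]
  rw [G_bra, h, amp23_comp, amp23_W]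

end RegMU
/-! ## Span arguments -/

/-- Continuous additive maps that are compatible with scalars up to a change of scalar. -/
structure AC {V V' : Type*} [NormedAddCommGroup V] [NormedSpace ℂ V]
    [NormedAddCommGroup V'] [NormedSpace ℂ V'] (f : V → V') : Prop where
  cont : Continuous f
  add : ∀ x y, f (x + y) = f x + f y
  smul : ∀ (c : ℂ) x, ∃ c' : ℂ, f (c • x) = c' • f x

namespace AC
variable {V V' V'' : Type*} [NormedAddCommGroup V] [NormedSpace ℂ V]
    [NormedAddCommGroup V'] [NormedSpace ℂ V'] [NormedAddCommGroup V''] [NormedSpace ℂ V'']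
    {E F G : Type*} [NormedAddCommGroup E] [InnerProductSpace ℂ E]
    [NormedAddCommGroup F] [InnerProductSpace ℂ F]
    [NormedAddCommGroup G] [InnerProductSpace ℂ G]

theorem id : AC (fun x : V => x) := ⟨continuous_id, fun _ _ => rfl, fun c _ => ⟨c, rfl⟩⟩

theorem app {f : V → V'} (h : AC f) (T : V' →L[ℂ] V'') : AC (fun x => T (f x)) :=
  ⟨T.continuous.comp h.cont, fun x y => by rw [h.add, map_add], fun c x => by
    obtain ⟨c', hc⟩ := h.smul c x
    exact ⟨c', by rw [hc, map_smul]⟩⟩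

theorem adj [CompleteSpace E] [CompleteSpace F] {f : V → E →L[ℂ] F} (h : AC f) :
    AC (fun x => adjoint (f x)) :=
  ⟨(LinearIsometryEquiv.continuous adjoint).comp h.cont, fun x y => by rw [h.add, map_add],
    fun c x => by
      obtain ⟨c', hc⟩ := h.smul c x
      exact ⟨starRingEnd ℂ c', by rw [hc, map_smulₛₗ]⟩⟩

theorem post {f : V → E →L[ℂ] F} (h : AC f) (A : F →L[ℂ] G) : AC (fun x => A ∘L f x) :=
  ⟨continuous_const.clm_comp h.cont, fun x y => by rw [h.add, comp_add], fun c x => by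
    obtain ⟨c', hc⟩ := h.smul c x
    exact ⟨c', by rw [hc, comp_smul]⟩⟩

theorem pre {f : V → F →L[ℂ] G} (h : AC f) (A : E →L[ℂ] F) : AC (fun x => f x ∘L A) :=
  ⟨h.cont.clm_comp continuous_const, fun x y => by rw [h.add, add_comp], fun c x => by
    obtain ⟨c', hc⟩ := h.smul c x
    exact ⟨c', by rw [hc, smul_comp]⟩⟩

end AC

theorem clS_ac {V V' : Type*} [NormedAddCommGroup V] [NormedSpace ℂ V]
    [NormedAddCommGroup V'] [NormedSpace ℂ V'] {S : Set V} {S' : Set V'} {f : V → V'}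
    (hf : AC f) (h : ∀ s ∈ S, f s ∈ clS S') {x : V} (hx : x ∈ clS S) : f x ∈ clS S' :=
  clS_map (clS S') (isClosed_clS S') f hf.cont hf.add hf.smul h hx

theorem tmul_ac {E F EF V' : Type*} [NormedAddCommGroup E] [InnerProductSpace ℂ E]
    [NormedAddCommGroup F] [InnerProductSpace ℂ F]
    [NormedAddCommGroup EF] [InnerProductSpace ℂ EF]
    [NormedAddCommGroup V'] [NormedSpace ℂ V'] (t : TensorPair E F EF) {S' : Set V'} {f : EF → V'}
    (hf : AC f) (h : ∀ a b, f (t.tmul a b) ∈ clS S') (x : EF) : f x ∈ clS S' :=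
  t.mem_of_tmul (clS S') (isClosed_clS S') f hf.cont hf.add hf.smul h x

namespace RegMU
variable {H H2 H3 : Type*}
    [NormedAddCommGroup H] [InnerProductSpace ℂ H] [CompleteSpace H]
    [NormedAddCommGroup H2] [InnerProductSpace ℂ H2] [CompleteSpace H2]
    [NormedAddCommGroup H3] [InnerProductSpace ℂ H3] [CompleteSpace H3]
    (M : RegMU H H2 H3)

def A : Submodule ℂ (H →L[ℂ] H) := clS {T | ∃ ξ η, T = M.rho ξ η}

theorem rho_mem (ξ η : H) : M.rho ξ η ∈ M.A := sub_clS ⟨ξ, η, rfl⟩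

theorem KWK_mem (x y : H2) : adjoint (M.K x) ∘L M.W12 ∘L M.K y ∈ M.A := by
  refine tmul_ac M.t2 (f := fun x => adjoint (M.K x) ∘L M.W12 ∘L M.K y)
    ((AC.id.app M.K).adj.pre _) (fun ξ ξ' => ?_) x
  refine tmul_ac M.t2 (f := fun y => adjoint (M.K (M.t2.tmul ξ ξ')) ∘L M.W12 ∘L M.K y)
    (((AC.id.app M.K).post _).post _) (fun η η' => ?_) y
  simp only [KWK]
  exact Submodule.smul_mem _ _ (M.rho_mem ξ η)

theorem mul_mem {a b : H →L[ℂ] H} (ha : a ∈ M.A) (hb : b ∈ M.A) : a ∘L b ∈ M.A := by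
  refine clS_ac (f := fun a => a ∘L b) (AC.id.pre b) ?_ ha
  rintro _ ⟨ξ, η, rfl⟩
  refine clS_ac (f := fun b => M.rho ξ η ∘L b) (AC.id.post _) ?_ hb
  rintro _ ⟨ξ', η', rfl⟩
  simp only [J1]
  exact M.KWK_mem _ _

theorem Psi_AC (ξ ξ' : H) : AC fun k : H →L[ℂ] H =>
    adjoint (M.R ξ) ∘L M.W ∘L M.two k ∘L adjoint M.W ∘L M.R ξ' :=
  (((AC.id.app M.two).pre _).post _).post _

theorem Psi_adj_mem (ξ ξ' : H) (k : H →L[ℂ] H) (hk : IsCompactOperator k) :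
    adjoint (adjoint (M.R ξ) ∘L M.W ∘L M.two k ∘L adjoint M.W ∘L M.R ξ') ∈ M.A := by
  refine clS_ac (M.Psi_AC ξ ξ').adj ?_ ((M.reg k).1 hk)
  rintro _ ⟨α, β, rfl⟩
  have := M.Psi_slice ξ ξ' α β
  simp only [L, R] at this ⊢
  rw [this, adjoint_comp, adjoint_comp, adjoint_adjoint, adjoint_adjoint,
    ContinuousLinearMap.comp_assoc]
  exact M.KWK_mem _ _

theorem rho_rho_adj_mem (ξ η ξ' η' : H) : M.rho ξ η ∘L adjoint (M.rho ξ' η') ∈ M.A := by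
  have := M.Psi_adj_mem ξ' ξ _ (isCompactOperator_rankOne η' η)
  rwa [Psi_rank, adjoint_comp, adjoint_adjoint] at this

theorem Psi_mem (ξ ξ' : H) (k : H →L[ℂ] H) (hk : IsCompactOperator k) :
    adjoint (M.R ξ) ∘L M.W ∘L M.two k ∘L adjoint M.W ∘L M.R ξ' ∈ M.A := by
  refine clS_ac (M.Psi_AC ξ ξ') ?_ (compact_mem_clS k hk)
  rintro _ ⟨α, β, rfl⟩
  simp only [Psi_rank]
  exact M.rho_rho_adj_mem _ _ _ _

theorem slice_compact (α β : H) : IsCompactOperator (adjoint (M.L α) ∘L M.W ∘L M.R β) :=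
  (M.reg _).2 (sub_clS ⟨α, β, rfl⟩)

theorem KWsK_mem (x y : H2) : adjoint (M.K x) ∘L adjoint M.W12 ∘L M.K y ∈ M.A := by
  refine tmul_ac M.t2 (f := fun x => adjoint (M.K x) ∘L adjoint M.W12 ∘L M.K y)
    ((AC.id.app M.K).adj.pre _) (fun α ξ => ?_) x
  have := tmul_ac M.t2 (S' := {T | ∃ ξ η, T = M.rho ξ η})
    (f := fun y => adjoint (M.K (M.t2.tmul α ξ)) ∘L adjoint M.W12 ∘L M.K (M.W y))
    ((((AC.id.app M.W).app M.K).post _).post _) (fun ξ' β => ?_) (adjoint M.W y)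
  · simpa only [M.uni2] using this
  · simp only [← Psi_slice]
    exact M.Psi_mem _ _ _ (M.slice_compact α β)

theorem rho_adj_mem (ξ η : H) : adjoint (M.rho ξ η) ∈ M.A := by
  by_cases h : ξ = 0
  · subst h
    have : M.rho 0 η = 0 := by simp [rho]
    rw [this, map_zero]
    exact Submodule.zero_mem _
  have h1 := M.KWsK_mem (M.t2.tmul η ξ) (M.t2.tmul ξ ξ)
  have h2 := congrArg adjoint (M.KWK ξ η ξ ξ)
  rw [adjoint_comp, adjoint_comp, adjoint_adjoint, ContinuousLinearMap.comp_assoc,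
    map_smulₛₗ] at h2
  rw [h2] at h1
  refine (Submodule.smul_mem_iff _ ?_).1 h1
  simpa using h

theorem adj_mem {a : H →L[ℂ] H} (ha : a ∈ M.A) : adjoint a ∈ M.A := by
  refine clS_ac AC.id.adj ?_ ha
  rintro _ ⟨ξ, η, rfl⟩
  exact M.rho_adj_mem ξ η

/-- To check a membership for all `a ∈ A` it suffices to check it for `(rho ξ η)*`. -/
theorem clS_adj {V' : Type*} [NormedAddCommGroup V'] [NormedSpace ℂ V'] {S' : Set V'}
    {f : (H →L[ℂ] H) → V'} (hf : AC f) (h : ∀ ξ η, f (adjoint (M.rho ξ η)) ∈ clS S')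
    {a : H →L[ℂ] H} (ha : a ∈ M.A) : f a ∈ clS S' := by
  have hf' : AC fun c => f (adjoint c) :=
    ⟨hf.cont.comp (LinearIsometryEquiv.continuous adjoint),
      fun x y => by rw [map_add, hf.add], fun c x => by
        obtain ⟨c', hc⟩ := hf.smul (starRingEnd ℂ c) (adjoint x)
        exact ⟨c', by rw [map_smulₛₗ, hc]⟩⟩
  have := clS_ac (S' := S') hf' (by rintro _ ⟨ξ, η, rfl⟩; exact h ξ η) (M.adj_mem ha)
  simpa using this

/-- To check a membership for all `a ∈ A` it suffices to check it for `rho ξ η`. -/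
theorem clS_rho {V' : Type*} [NormedAddCommGroup V'] [NormedSpace ℂ V'] {S' : Set V'}
    {f : (H →L[ℂ] H) → V'} (hf : AC f) (h : ∀ ξ η, f (M.rho ξ η) ∈ clS S')
    {a : H →L[ℂ] H} (ha : a ∈ M.A) : f a ∈ clS S' :=
  clS_ac (S' := S') hf (by rintro _ ⟨ξ, η, rfl⟩; exact h ξ η) ha

def N : Submodule ℂ (H →L[ℂ] H2) := clS {T | ∃ α, ∃ b ∈ M.A, T = M.R α ∘L b}
def Q : Submodule ℂ (H →L[ℂ] H2) := clS {T | ∃ α, ∃ b ∈ M.A, T = M.W ∘L M.R α ∘L b}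
def D : Submodule ℂ (H →L[ℂ] H2) := clS {T | ∃ a ∈ M.A, ∃ η, T = M.two a ∘L M.W ∘L M.R η}

theorem f_AC (η' : H) : AC fun k : H →L[ℂ] H => M.W ∘L M.two k ∘L adjoint M.W ∘L M.R η' :=
  ((AC.id.app M.two).pre _).post _

theorem f_mem_N (η' : H) (k : H →L[ℂ] H) (hk : IsCompactOperator k) :
    M.W ∘L M.two k ∘L adjoint M.W ∘L M.R η' ∈ M.N := by
  refine clS_ac (M.f_AC η') ?_ ((M.reg k).1 hk)
  rintro _ ⟨α, β, rfl⟩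
  have := M.f_slice η' α β
  simp only [L, R] at this ⊢
  rw [this]
  refine tmul_ac M.t2 (f := fun y => adjoint (M.R13 α) ∘L adjoint M.W12 ∘L M.K y)
    (((AC.id.app M.K).post _).post _) (fun η β => ?_) _
  simp only [f_elem]
  exact sub_clS ⟨_, _, M.rho_adj_mem _ _, rfl⟩

theorem f_mem_Q (η' : H) (k : H →L[ℂ] H) (hk : IsCompactOperator k) :
    M.W ∘L M.two k ∘L adjoint M.W ∘L M.R η' ∈ M.Q := by
  refine clS_ac (M.f_AC η') ?_ (compact_mem_clS k hk)
  rintro _ ⟨α, β, rfl⟩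
  simp only [f_rank]
  exact sub_clS ⟨_, _, M.rho_adj_mem _ _, rfl⟩

theorem Q_le_N : M.Q ≤ M.N := by
  refine clS_le (isClosed_clS _) ?_
  rintro _ ⟨α, b, hb, rfl⟩
  refine M.clS_adj (f := fun b => M.W ∘L M.R α ∘L b) ((AC.id.post _).post _) (fun η' ζ => ?_) hb
  simp only [← f_rank]
  exact M.f_mem_N _ _ (isCompactOperator_rankOne _ _)

theorem N_le_Q : M.N ≤ M.Q := by
  refine clS_le (isClosed_clS _) ?_
  rintro _ ⟨β, b, hb, rfl⟩
  refine M.clS_adj (f := fun b => M.R β ∘L b) (AC.id.post _) (fun η α => ?_) hb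
  simp only [← f_elem]
  have := tmul_ac M.t2 (S' := {T | ∃ α, ∃ b ∈ M.A, T = M.W ∘L M.R α ∘L b})
    (f := fun y => adjoint (M.R13 α) ∘L adjoint M.W12 ∘L M.K (M.W y))
    ((((AC.id.app M.W).app M.K).post _).post _) (fun η' β => ?_)
    (adjoint M.W (M.t2.tmul η β))
  · simpa only [M.uni2] using this
  · simp only [← f_slice]
    exact M.f_mem_Q _ _ (M.slice_compact α β)

theorem Q_le_D : M.Q ≤ M.D := by
  refine clS_le (isClosed_clS _) ?_
  rintro _ ⟨η, b, hb, rfl⟩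
  refine M.clS_rho (f := fun b => M.W ∘L M.R η ∘L b) ((AC.id.post _).post _) (fun ξ' η' => ?_) hb
  simp only [E_one]
  refine tmul_ac M.t2 (f := fun y => adjoint (M.R12 ξ') ∘L M.W23 ∘L M.W12 ∘L M.K y)
    ((((AC.id.app M.K).post _).post _).post _) (fun η η' => ?_) _
  simp only [E_elem]
  exact sub_clS ⟨_, M.rho_mem _ _, _, rfl⟩

theorem D_le_Q : M.D ≤ M.Q := by
  refine clS_le (isClosed_clS _) ?_
  rintro _ ⟨a, ha, η, rfl⟩
  refine M.clS_rho (f := fun a => M.two a ∘L M.W ∘L M.R η) ((AC.id.app M.two).pre _)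
    (fun ξ' η' => ?_) ha
  simp only [← E_elem]
  have := tmul_ac M.t2 (S' := {T | ∃ α, ∃ b ∈ M.A, T = M.W ∘L M.R α ∘L b})
    (f := fun y => adjoint (M.R12 ξ') ∘L M.W23 ∘L M.W12 ∘L M.K (adjoint M.W y))
    (((((AC.id.app (adjoint M.W)).app M.K).post _).post _).post _) (fun η η' => ?_)
    (M.W (M.t2.tmul η η'))
  · simpa only [M.uni1] using this
  · simp only [← E_one]
    exact sub_clS ⟨_, _, M.rho_mem _ _, rfl⟩

/-- `Δ(a) = W*(1 ⊗ a)W`. -/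
def Dl (a : H →L[ℂ] H) : H2 →L[ℂ] H2 := adjoint M.W ∘L M.two a ∘L M.W

theorem Dl_AC : AC M.Dl := ((AC.id.app M.two).pre _).post _

def FN : Submodule ℂ (H2 →L[ℂ] H2) := clS {T | ∃ ξ, ∃ S ∈ M.N, T = M.F ξ S}
def Mn : Submodule ℂ (H2 →L[ℂ] H2) :=
  clS {T | ∃ a ∈ M.A, ∃ b ∈ M.A, T = M.one a ∘L M.two b}
def S1 : Submodule ℂ (H2 →L[ℂ] H2) :=
  clS {T | ∃ a ∈ M.A, ∃ b ∈ M.A, T = M.Dl a ∘L M.one b}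
def S2 : Submodule ℂ (H2 →L[ℂ] H2) :=
  clS {T | ∃ a ∈ M.A, ∃ b ∈ M.A, T = M.Dl a ∘L M.two b}

theorem F_AC (ξ : H) : AC (M.F ξ) := ((AC.id.app M.amp23).post _).post _

theorem Mn_eq : M.Mn = M.FN := by
  apply le_antisymm
  · refine clS_le (isClosed_clS _) ?_
    rintro _ ⟨a, ha, b, hb, rfl⟩
    refine M.clS_rho (f := fun a => M.one a ∘L M.two b) ((AC.id.app M.one).pre _)
      (fun ξ η => ?_) ha
    simp only [← F_R]
    exact sub_clS ⟨_, _, sub_clS ⟨_, _, hb, rfl⟩, rfl⟩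
  · refine clS_le (isClosed_clS _) ?_
    rintro _ ⟨ξ, T, hT, rfl⟩
    refine clS_ac (M.F_AC ξ) ?_ hT
    rintro _ ⟨α, b, hb, rfl⟩
    rw [F_R]
    exact sub_clS ⟨_, M.rho_mem _ _, _, hb, rfl⟩

theorem S2_eq : M.S2 = M.FN := by
  apply le_antisymm
  · refine clS_le (isClosed_clS _) ?_
    rintro _ ⟨a, ha, b, hb, rfl⟩
    refine M.clS_rho (f := fun a => M.Dl a ∘L M.two b) (M.Dl_AC.pre _)
      (fun ξ η => ?_) ha
    simp only [Dl, ← F_W]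
    exact sub_clS ⟨_, _, M.Q_le_N (sub_clS ⟨_, _, hb, rfl⟩), rfl⟩
  · refine clS_le (isClosed_clS _) ?_
    rintro _ ⟨ξ, T, hT, rfl⟩
    refine clS_ac (M.F_AC ξ) ?_ (M.N_le_Q hT)
    rintro _ ⟨α, b, hb, rfl⟩
    rw [F_W]
    exact sub_clS ⟨_, M.rho_mem _ _, _, hb, rfl⟩

theorem Y_AC (η' : H) : AC (M.Y η') := (AC.id.app M.K).adj.pre _

theorem S1_eq : M.S1 = M.FN := by
  apply le_antisymm
  · refine clS_le (isClosed_clS _) ?_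
    rintro _ ⟨a, ha, b, hb, rfl⟩
    refine M.clS_rho (f := fun a => M.Dl a ∘L M.one b) (M.Dl_AC.pre _)
      (fun ξ η => ?_) ha
    simp only [Dl, ← G_one]
    refine M.clS_rho
      (f := fun b => M.G (adjoint (M.R ξ) ∘L M.W ∘L M.one b) ∘L M.W23 ∘L M.R12 η)
      (((((AC.id.app M.one).post _).post _).app M.G).pre _) (fun ξ' η' => ?_) hb
    simp only [← Y_one]
    refine tmul_ac M.t2 (f := fun x => M.G (M.Y η' x) ∘L M.W23 ∘L M.R12 η)
      (((M.Y_AC η').app M.G).pre _) (fun ξ ξ' => ?_) _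
    simp only [Y_two, G_two]
    exact sub_clS ⟨_, _, M.Q_le_N (M.D_le_Q (sub_clS ⟨_, M.rho_adj_mem _ _, _, rfl⟩)), rfl⟩
  · refine clS_le (isClosed_clS _) ?_
    rintro _ ⟨ξ, T, hT, rfl⟩
    refine clS_ac (M.F_AC ξ) ?_ (M.Q_le_D (M.N_le_Q hT))
    rintro _ ⟨a, ha, η, rfl⟩
    rw [← G_two]
    refine M.clS_adj
      (f := fun a => M.G (adjoint (M.R ξ) ∘L M.W ∘L M.two a) ∘L M.W23 ∘L M.R12 η)
      (((((AC.id.app M.two).post _).post _).app M.G).pre _) (fun η' ξ' => ?_) ha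
    simp only [← Y_two]
    have := tmul_ac M.t2 (S' := {T | ∃ a ∈ M.A, ∃ b ∈ M.A, T = M.Dl a ∘L M.one b})
      (f := fun x => M.G (M.Y η' (adjoint M.W x)) ∘L M.W23 ∘L M.R12 η)
      ((AC.app (V' := H2 →L[ℂ] H) ?_ M.G).pre _) (fun ξ ξ' => ?_) (M.W (M.t2.tmul ξ ξ'))
    · simpa only [M.uni1] using this
    · exact ((AC.id.app (adjoint M.W)).app M.K).adj.pre _
    · simp only [Y_one, G_one]
      exact sub_clS ⟨_, M.rho_mem _ _, _, M.rho_mem _ _, rfl⟩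

theorem Mn_two {x : H2 →L[ℂ] H2} (hx : x ∈ M.Mn) {c : H →L[ℂ] H} (hc : c ∈ M.A) :
    x ∘L M.two c ∈ M.Mn := by
  refine clS_ac (f := fun x => x ∘L M.two c) (AC.id.pre _) ?_ hx
  rintro _ ⟨a, ha, b, hb, rfl⟩
  refine sub_clS ⟨a, ha, _, M.mul_mem hb hc, ?_⟩
  ext v
  simp only [comp_apply, two_two]

theorem Mn_adj {x : H2 →L[ℂ] H2} (hx : x ∈ M.Mn) : adjoint x ∈ M.Mn := by
  refine clS_ac AC.id.adj ?_ hx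
  rintro _ ⟨a, ha, b, hb, rfl⟩
  refine sub_clS ⟨_, M.adj_mem ha, _, M.adj_mem hb, ?_⟩
  rw [adjoint_comp, ← one_adj, ← two_adj]
  ext v
  simp only [comp_apply, one_two]

theorem mult_left {a : H →L[ℂ] H} (ha : a ∈ M.A) {x : H2 →L[ℂ] H2} (hx : x ∈ M.Mn) :
    M.Dl a ∘L x ∈ M.Mn := by
  refine clS_ac (f := fun x => M.Dl a ∘L x) (AC.id.post _) ?_ hx
  rintro _ ⟨b, hb, c, hc, rfl⟩
  rw [← ContinuousLinearMap.comp_assoc]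
  refine M.Mn_two ?_ hc
  rw [Mn_eq, ← S1_eq]
  exact sub_clS ⟨a, ha, b, hb, rfl⟩

theorem Dl_adj (a : H →L[ℂ] H) : adjoint (M.Dl (adjoint a)) = M.Dl a := by
  simp only [Dl, adjoint_comp, two_adj, adjoint_adjoint, ContinuousLinearMap.comp_assoc]

theorem mult_right {a : H →L[ℂ] H} (ha : a ∈ M.A) {x : H2 →L[ℂ] H2} (hx : x ∈ M.Mn) :
    x ∘L M.Dl a ∈ M.Mn := by
  have := M.Mn_adj (M.mult_left (M.adj_mem ha) (M.Mn_adj hx))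
  rwa [adjoint_comp, adjoint_adjoint, Dl_adj] at this

end RegMU
/-! ## Translation of the statement -/

theorem sg_flip {H H2 : Type*}
    [NormedAddCommGroup H] [InnerProductSpace ℂ H]
    [NormedAddCommGroup H2] [InnerProductSpace ℂ H2]
    (t2 : TensorPair H H H2) (Sg : H2 →L[ℂ] H2) (hSg : ∀ a b : H, Sg (t2.tmul a b) = t2.tmul b a)
    (ζ ξ : H) (v : H2) : ⟪t2.tmul ζ ξ, Sg v⟫_ℂ = ⟪t2.tmul ξ ζ, v⟫_ℂ := by
  have : (innerSL ℂ (t2.tmul ζ ξ)) ∘L Sg = innerSL ℂ (t2.tmul ξ ζ) :=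
    t2.ext_clm fun a b => by
      simp [hSg, t2.inner_tmul, mul_comm]
  exact (DFunLike.congr_fun this v)

theorem slices_flip {H H2 : Type*}
    [NormedAddCommGroup H] [InnerProductSpace ℂ H] [CompleteSpace H]
    [NormedAddCommGroup H2] [InnerProductSpace ℂ H2] [CompleteSpace H2]
    (t2 : TensorPair H H H2) (W Sg : H2 →L[ℂ] H2)
    (hSg : ∀ a b : H, Sg (t2.tmul a b) = t2.tmul b a) :
    slicesR t2 t2 (Sg * W) =
      {k : H →L[ℂ] H | ∃ α β, k = adjoint (t2.ketL α) ∘L W ∘L t2.ketR β} := by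
  ext T
  simp only [slicesR, Set.mem_ofPred_eq]
  refine exists_congr fun ξ => exists_congr fun η => ⟨fun h => ?_, fun h => ?_⟩
  · ext ζ'
    refine ext_inner_left ℂ fun ζ => ?_
    rw [h, mul_def, comp_apply Sg W, sg_flip t2 Sg hSg]
    simp [adjoint_inner_right]
  · intro ζ ζ'
    rw [h, mul_def, comp_apply Sg W, sg_flip t2 Sg hSg]
    simp [adjoint_inner_right]

namespace RegMU
variable {H H2 H3 : Type*}
    [NormedAddCommGroup H] [InnerProductSpace ℂ H] [CompleteSpace H]
    [NormedAddCommGroup H2] [InnerProductSpace ℂ H2] [CompleteSpace H2]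
    [NormedAddCommGroup H3] [InnerProductSpace ℂ H3] [CompleteSpace H3]
    (M : RegMU H H2 H3)

theorem hatA_eq : hatA M.t2 M.W = (M.A : Set (H →L[ℂ] H)) := by
  have : slicesR M.t2 M.t2 M.W = {T | ∃ ξ η, T = M.rho ξ η} := by
    ext T
    simp only [slicesR, Set.mem_ofPred_eq]
    refine exists_congr fun ξ => exists_congr fun η => ⟨fun h => ?_, fun h => ?_⟩
    · ext ζ'
      refine ext_inner_left ℂ fun ζ => ?_
      rw [h]
      simp [rho, R, adjoint_inner_right]
    · intro ζ ζ'
      rw [h]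
      simp [rho, R, adjoint_inner_right]
  rw [hatA, this]
  rfl

theorem isTensorOp_iff (a b : H →L[ℂ] H) (T : H2 →L[ℂ] H2) :
    IsTensorOp M.t2 M.t2 a b T ↔ T = M.one a ∘L M.two b := by
  constructor
  · intro h
    refine TensorPair.ext_op M.t2 M.t2 fun x y z w => ?_
    rw [h, comp_apply, two_tmul, one_tmul, TensorPair.inner_tmul]
  · rintro rfl x y z w
    rw [comp_apply, two_tmul, one_tmul, TensorPair.inner_tmul]

theorem one_id : M.one 1 = 1 := M.t2.ext_clm fun x y => by rw [one_tmul]; rfl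
theorem two_id : M.two 1 = 1 := M.t2.ext_clm fun x y => by rw [two_tmul]; rfl

theorem isTensorOp_two (a : H →L[ℂ] H) (T : H2 →L[ℂ] H2) :
    IsTensorOp M.t2 M.t2 1 a T ↔ T = M.two a := by
  rw [isTensorOp_iff, one_id]; rfl
theorem isTensorOp_one (a : H →L[ℂ] H) (T : H2 →L[ℂ] H2) :
    IsTensorOp M.t2 M.t2 a 1 T ↔ T = M.one a := by
  rw [isTensorOp_iff, two_id]; rfl

theorem minTensor_eq : minTensor M.t2 (hatA M.t2 M.W) (hatA M.t2 M.W) =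
    (M.Mn : Set (H2 →L[ℂ] H2)) := by
  simp only [minTensor, hatA_eq, isTensorOp_iff]
  rfl

theorem main :
    cspan {y : H2 →L[ℂ] H2 | ∃ a ∈ hatA M.t2 M.W, ∃ b ∈ hatA M.t2 M.W,
        ∃ Ta Tb : H2 →L[ℂ] H2, IsTensorOp M.t2 M.t2 1 a Ta ∧ IsTensorOp M.t2 M.t2 b 1 Tb ∧
          y = (star M.W * Ta * M.W) * Tb}
      = minTensor M.t2 (hatA M.t2 M.W) (hatA M.t2 M.W) ∧
    cspan {y : H2 →L[ℂ] H2 | ∃ a ∈ hatA M.t2 M.W, ∃ b ∈ hatA M.t2 M.W,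
        ∃ Ta Tb : H2 →L[ℂ] H2, IsTensorOp M.t2 M.t2 1 a Ta ∧ IsTensorOp M.t2 M.t2 1 b Tb ∧
          y = (star M.W * Ta * M.W) * Tb}
      = minTensor M.t2 (hatA M.t2 M.W) (hatA M.t2 M.W) ∧
    (∀ a ∈ hatA M.t2 M.W, ∀ Ta : H2 →L[ℂ] H2, IsTensorOp M.t2 M.t2 1 a Ta →
      ∀ x ∈ minTensor M.t2 (hatA M.t2 M.W) (hatA M.t2 M.W),
        (star M.W * Ta * M.W) * x ∈ minTensor M.t2 (hatA M.t2 M.W) (hatA M.t2 M.W) ∧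
        x * (star M.W * Ta * M.W) ∈ minTensor M.t2 (hatA M.t2 M.W) (hatA M.t2 M.W)) := by
  rw [minTensor_eq, hatA_eq]
  simp only [isTensorOp_one, isTensorOp_two, exists_and_left, exists_eq_left]
  refine ⟨?_, ?_, ?_⟩
  · rw [Mn_eq, ← S1_eq]; rfl
  · rw [Mn_eq, ← S2_eq]; rfl
  · rintro a ha _ rfl x hx
    exact ⟨M.mult_left ha hx, M.mult_right ha hx⟩

end RegMU
/-- For a regular multiplicative unitary `W` on `H` and
`Δ̂ᵒᵖ(a) := W*(1 ⊗ a)W`, the Podleś conditions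
`[Δ̂ᵒᵖ(Â(W))·(Â(W) ⊗ 1)] = Â(W) ⊗min Â(W) = [Δ̂ᵒᵖ(Â(W))·(1 ⊗ Â(W))]` hold; in
particular `Δ̂ᵒᵖ` maps `Â(W)` into the multipliers of `Â(W) ⊗min Â(W)`. -/
theorem statement10
    {H H2 H3 : Type*}
    [NormedAddCommGroup H] [InnerProductSpace ℂ H] [CompleteSpace H]
    [NormedAddCommGroup H2] [InnerProductSpace ℂ H2] [CompleteSpace H2]
    [NormedAddCommGroup H3] [InnerProductSpace ℂ H3] [CompleteSpace H3]
    -- realizations of the tensor products H ⊗ H and H ⊗ H ⊗ H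
    (t2 : TensorPair H H H2) (t3 : TensorTriple H H H H3)
    -- W is a unitary on H ⊗ H
    (W : H2 →L[ℂ] H2) (hWu : star W * W = 1 ∧ W * star W = 1)
    -- the legs W₁₂, W₂₃, W₁₃ of W on H ⊗ H ⊗ H
    (W12 W23 W13 : H3 →L[ℂ] H3)
    (hW12 : IsLeg12 t2 t3 W W12) (hW23 : IsLeg23 t2 t3 W W23)
    (hW13 : IsLeg13 t2 t3 W W13)
    -- the pentagon equation W₂₃W₁₂ = W₁₂W₁₃W₂₃
    (hpent : W23 * W12 = W12 * W13 * W23)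
    -- the tensor flip Σ on H ⊗ H
    (Sg : H2 →L[ℂ] H2) (hSg : ∀ a b : H, Sg (t2.tmul a b) = t2.tmul b a)
    -- regularity: C(W) = K(H)
    (hreg : hatA t2 (Sg * W) = {T : H →L[ℂ] H | IsCompactOperator T}) :
    cspan {y : H2 →L[ℂ] H2 | ∃ a ∈ hatA t2 W, ∃ b ∈ hatA t2 W,
        ∃ Ta Tb : H2 →L[ℂ] H2, IsTensorOp t2 t2 1 a Ta ∧ IsTensorOp t2 t2 b 1 Tb ∧
          y = (star W * Ta * W) * Tb}
      = minTensor t2 (hatA t2 W) (hatA t2 W) ∧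
    cspan {y : H2 →L[ℂ] H2 | ∃ a ∈ hatA t2 W, ∃ b ∈ hatA t2 W,
        ∃ Ta Tb : H2 →L[ℂ] H2, IsTensorOp t2 t2 1 a Ta ∧ IsTensorOp t2 t2 1 b Tb ∧
          y = (star W * Ta * W) * Tb}
      = minTensor t2 (hatA t2 W) (hatA t2 W) ∧
    (∀ a ∈ hatA t2 W, ∀ Ta : H2 →L[ℂ] H2, IsTensorOp t2 t2 1 a Ta →
      ∀ x ∈ minTensor t2 (hatA t2 W) (hatA t2 W),
        (star W * Ta * W) * x ∈ minTensor t2 (hatA t2 W) (hatA t2 W) ∧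
        x * (star W * Ta * W) ∈ minTensor t2 (hatA t2 W) (hatA t2 W)) := by
  have e12 : (TensorTriple.pair t2 t3).amp (TensorTriple.pair t2 t3) W = W12 := by
    refine t3.ext_op fun a b c a' b' c' => ?_
    rw [hW12, ← TensorTriple.pair_tmul t2 t3, ← TensorTriple.pair_tmul t2 t3, TensorPair.amp_tmul,
      TensorPair.inner_tmul]
  have e13 : (TensorTriple.pair t2 t3.perm).amp (TensorTriple.pair t2 t3.perm) W = W13 := by
    refine t3.ext_op fun a b c a' b' c' => ?_
    have e : ∀ a b c, t3.tmul a b c =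
        (TensorTriple.pair t2 t3.perm).tmul (t2.tmul a c) b := fun a b c => by
      rw [TensorTriple.pair_tmul]; rfl
    rw [hW13, e, e, TensorPair.amp_tmul, TensorPair.inner_tmul]
  have e23 : (TensorTriple.pair t2 t3.perm'.perm).amp (TensorTriple.pair t2 t3.perm'.perm) W
      = W23 := by
    refine t3.ext_op fun a b c a' b' c' => ?_
    have e : ∀ a b c, t3.tmul a b c =
        (TensorTriple.pair t2 t3.perm'.perm).tmul (t2.tmul b c) a := fun a b c => by
      rw [TensorTriple.pair_tmul]; rfl
    rw [hW23, e, e, TensorPair.amp_tmul, TensorPair.inner_tmul]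
  let M : RegMU H H2 H3 :=
    { t2 := t2
      t3 := t3
      W := W
      uni1 := fun x => DFunLike.congr_fun hWu.1 x
      uni2 := fun x => DFunLike.congr_fun hWu.2 x
      pent := fun x => by
        rw [e12, e13, e23]
        exact DFunLike.congr_fun hpent x
      reg := fun k => by
        rw [hatA, slices_flip t2 W Sg hSg] at hreg
        exact (Set.ext_iff.1 hreg k).symm }
  exact M.main

end
end

section
/- Let W be a regular multiplicative unitary on a complex Hilbert space H and let U be a corepresentation of W on a Hilbert space M. Then the closed linear span of the slices (id ⊗ ω_{ξ,η})(Σ_{M,H} U) over ξ ∈ M, η ∈ H, i.e. of the operators T_{ξ,η} : M → H determined by ⟨h, T_{ξ,η} m⟩ = ⟨h ⊗ ξ, Σ_{M,H} U (m ⊗ η)⟩, equals K(M, H), the compact operators from M to H. -/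
/-!
Common framework: we axiomatize realizations of Hilbert-space tensor products.
A `TensorPair E F EF` realizes the Hilbert tensor product `E ⊗ F` as the Hilbert
space `EF`: it consists of a bilinear map `(a, b) ↦ a ⊗ b` whose image satisfies
the characteristic inner-product identity and has total (dense) linear span.
Operators such as the leg operators `X₁₂`, `X₂₃`, `X₁₃`, amplifications `a ⊗ b`,
and the tensor flip `Σ` are then uniquely characterized by their matrix
coefficients against elementary tensors.
-/

noncomputable section

open scoped InnerProductSpace
open ContinuousLinearMap

section Helpers

variable {E F G EF EFG V : Type*}
    [NormedAddCommGroup E] [InnerProductSpace ℂ E]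
    [NormedAddCommGroup F] [InnerProductSpace ℂ F]
    [NormedAddCommGroup G] [InnerProductSpace ℂ G]
    [NormedAddCommGroup EF] [InnerProductSpace ℂ EF]
    [NormedAddCommGroup EFG] [InnerProductSpace ℂ EFG]
    [NormedAddCommGroup V] [NormedSpace ℂ V]

lemma TensorPair.norm_tmul_s11 (t : TensorPair E F EF) (a : E) (b : F) :
    ‖t.tmul a b‖ = ‖a‖ * ‖b‖ := by
  have h := t.inner_tmul a a b b
  simp only [inner_self_eq_norm_sq_to_K] at h
  have h2 : ‖t.tmul a b‖ ^ 2 = (‖a‖ * ‖b‖) ^ 2 := by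
    rw [mul_pow]
    exact_mod_cast h
  exact (pow_left_inj₀ (norm_nonneg _) (by positivity) two_ne_zero).1 h2

def TensorPair.L (t : TensorPair E F EF) : E →L[ℂ] F →L[ℂ] EF :=
  t.tmul.mkContinuous₂ 1 fun a b => by rw [t.norm_tmul_s11, one_mul]

lemma TensorPair.L_apply (t : TensorPair E F EF) (a : E) (b : F) : t.L a b = t.tmul a b := rfl

lemma TensorPair.ext_clm_s11 (t : TensorPair E F EF) {f g : EF →L[ℂ] V}
    (h : ∀ a b, f (t.tmul a b) = g (t.tmul a b)) : f = g := by
  apply ContinuousLinearMap.ext_on t.dense_span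
  rintro _ ⟨a, b, rfl⟩
  exact h a b

lemma TensorTriple.ext_clm_s11 (t : TensorTriple E F G EFG) {f g : EFG →L[ℂ] V}
    (h : ∀ a b c, f (t.tmul a b c) = g (t.tmul a b c)) : f = g := by
  apply ContinuousLinearMap.ext_on t.dense_span
  rintro _ ⟨a, b, c, rfl⟩
  exact h a b c

lemma TensorTriple.ext_inner (t : TensorTriple E F G EFG) {x y : EFG}
    (h : ∀ a b c, ⟪t.tmul a b c, x⟫_ℂ = ⟪t.tmul a b c, y⟫_ℂ) : x = y := by
  have h2 : innerSL ℂ x = innerSL ℂ y := by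
    apply t.ext_clm_s11
    intro a b c
    simp only [innerSL_apply_apply]
    rw [← inner_conj_symm, h, inner_conj_symm]
  refine ext_inner_right ℂ fun v => ?_
  simpa using congrArg (fun f => f v) h2

/-- Closed-subspace induction on the tensor product for conjugate-linear maps. -/
lemma TensorPair.mem_of_conj (t : TensorPair E F EF) (S : Submodule ℂ V)
    (hS : IsClosed (S : Set V)) (Θ : EF → V) (hc : Continuous Θ)
    (hadd : ∀ x y, Θ (x + y) = Θ x + Θ y)
    (hsmul : ∀ (c : ℂ) x, Θ (c • x) = (starRingEnd ℂ) c • Θ x)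
    (h : ∀ a b, Θ (t.tmul a b) ∈ S) (v : EF) : Θ v ∈ S := by
  have hcl : IsClosed {v | Θ v ∈ S} := hS.preimage hc
  refine (hcl.closure_subset_iff.2 ?_) (t.dense_span v)
  intro x hx
  change Θ x ∈ S
  induction hx using Submodule.span_induction with
  | mem x hx => obtain ⟨a, b, rfl⟩ := hx; exact h a b
  | zero =>
    have := hsmul 0 0
    simp only [zero_smul, map_zero] at this
    rw [this]; exact S.zero_mem
  | add x y _ _ hx hy => rw [hadd]; exact S.add_mem hx hy
  | smul c x _ hx => rw [hsmul]; exact S.smul_mem _ hx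

lemma TensorPair.exists_ext [CompleteSpace EFG] (t : TensorPair E F EF)
    (f : E →ₗ[ℂ] F →ₗ[ℂ] EFG) (C : ℝ)
    (hf : ∀ a b a' b', ⟪f a b, f a' b'⟫_ℂ = (C : ℂ) ^ 2 * (⟪a, a'⟫_ℂ * ⟪b, b'⟫_ℂ)) :
    ∃ j : EF →L[ℂ] EFG, ∀ a b, j (t.tmul a b) = f a b := by
  have key : ∀ x y : TensorProduct ℂ E F,
      ⟪TensorProduct.lift f x, TensorProduct.lift f y⟫_ℂ
        = (C : ℂ) ^ 2 * ⟪TensorProduct.lift t.tmul x, TensorProduct.lift t.tmul y⟫_ℂ := by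
    intro x y
    induction x using TensorProduct.induction_on with
    | zero => simp
    | add x x' hx hx' => simp only [map_add, inner_add_left, hx, hx', mul_add]
    | tmul a b =>
      induction y using TensorProduct.induction_on with
      | zero => simp
      | add x x' hx hx' => simp only [map_add, inner_add_right, hx, hx', mul_add]
      | tmul a' b' => simp [hf, t.inner_tmul]
  have hn : ∀ x : TensorProduct ℂ E F,
      ‖TensorProduct.lift f x‖ ≤ |C| * ‖TensorProduct.lift t.tmul x‖ := by
    intro x
    have h := key x x
    simp only [inner_self_eq_norm_sq_to_K] at h
    have h2 : ‖TensorProduct.lift f x‖ ^ 2 = C ^ 2 * ‖TensorProduct.lift t.tmul x‖ ^ 2 := by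
      simp only [Complex.coe_algebraMap] at h
      exact_mod_cast h
    rw [← sq_abs C, ← mul_pow] at h2
    exact ((pow_left_inj₀ (norm_nonneg _) (by positivity) two_ne_zero).1 h2).le
  have hd : DenseRange (TensorProduct.lift t.tmul) := by
    have h1 : (Submodule.span ℂ {z : EF | ∃ a b, z = t.tmul a b} : Set EF)
        ⊆ Set.range (TensorProduct.lift t.tmul) := by
      have : Submodule.span ℂ {z : EF | ∃ a b, z = t.tmul a b}
          ≤ LinearMap.range (TensorProduct.lift t.tmul) := by
        rw [Submodule.span_le]
        rintro _ ⟨a, b, rfl⟩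
        exact ⟨TensorProduct.tmul ℂ a b, by simp⟩
      intro x hx
      exact this hx
    exact t.dense_span.mono h1
  refine ⟨(TensorProduct.lift f).extendOfNorm (TensorProduct.lift t.tmul), fun a b => ?_⟩
  have := LinearMap.extendOfNorm_eq (f := TensorProduct.lift f) hd ⟨|C|, hn⟩ (TensorProduct.tmul ℂ a b)
  simpa using this

/-- finite-rank approximation of compact operators into a Hilbert space -/
lemma compact_mem_of_rankOne [CompleteSpace E] [CompleteSpace F]
    (S : Submodule ℂ (E →L[ℂ] F))
    (hS : IsClosed (S : Set (E →L[ℂ] F)))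
    (h1 : ∀ (a : F) (m : E), InnerProductSpace.rankOne ℂ a m ∈ S)
    (T : E →L[ℂ] F) (hT : IsCompactOperator T) : T ∈ S := by
  rw [← SetLike.mem_coe, ← hS.closure_eq, Metric.mem_closure_iff]
  intro ε hε
  obtain ⟨K, hK, hKs⟩ := IsCompactOperator.image_closedBall_subset_compact
    (𝕜₁ := ℂ) (f := (T : E →ₗ[ℂ] F)) hT 1
  obtain ⟨s, hs, hsK⟩ := Metric.totallyBounded_iff.1 hK.totallyBounded (ε / 2) (by positivity)
  haveI : FiniteDimensional ℂ (Submodule.span ℂ s) := FiniteDimensional.span_of_finite ℂ hs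
  set P := (Submodule.span ℂ s).starProjection with hP
  refine ⟨P ∘L T, ?_, ?_⟩
  · let b := stdOrthonormalBasis ℂ (Submodule.span ℂ s)
    have : P ∘L T = ∑ i, InnerProductSpace.rankOne ℂ (b i : F) (adjoint T (b i : F)) := by
      ext x
      simp only [ContinuousLinearMap.sum_apply, InnerProductSpace.rankOne_apply,
        adjoint_inner_left, comp_apply, hP]
      rw [b.starProjection_eq_sum_rankOne]
      simp
    rw [this]
    exact S.sum_mem fun i _ => h1 _ _
  · rw [dist_eq_norm]
    refine lt_of_le_of_lt (ContinuousLinearMap.opNorm_le_of_unit_norm (C := ε / 2)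
      (by positivity) ?_) (half_lt_self hε)
    intro x hx
    have hxK : T x ∈ K := hKs ⟨x, by simp [hx], rfl⟩
    obtain ⟨y, hy, hxy⟩ := Set.mem_iUnion₂.1 (hsK hxK)
    have hy' : P y = y :=
      Submodule.starProjection_eq_self_iff.2 (Submodule.subset_span hy)
    have e : (T - P ∘L T) x = (T x - y) - P (T x - y) := by
      simp [map_sub, hy']
    rw [e]
    have h2 : ‖(T x - y) - P (T x - y)‖ ≤ ‖T x - y‖ := by
      rw [hP, ← Submodule.starProjection_orthogonal_val]
      exact Submodule.norm_starProjection_apply_le _ _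
    rw [Metric.mem_ball, dist_eq_norm] at hxy
    exact h2.trans hxy.le

lemma isCompactOperator_rankOne_s11 [CompleteSpace E] (a : F) (m : E) :
    IsCompactOperator (InnerProductSpace.rankOne ℂ a m) := by
  rw [InnerProductSpace.rankOne_def']
  have h : IsCompactOperator (toSpanSingleton ℂ a) :=
    isCompactOperator_of_locallyCompactSpace_rng (toSpanSingleton ℂ a)
  exact h.comp_clm (innerSL ℂ m)

/-- slice operator -/
def TensorPair.slice [CompleteSpace F] [CompleteSpace EF] (t : TensorPair E F EF)
    (X : EF →L[ℂ] EF) (ξ : E) (η : F) : E →L[ℂ] F :=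
  adjoint (t.L ξ) ∘L X ∘L t.L.flip η

lemma TensorPair.inner_slice [CompleteSpace F] [CompleteSpace EF] (t : TensorPair E F EF)
    (X : EF →L[ℂ] EF) (ξ : E) (η : F) (h : F) (m : E) :
    ⟪h, t.slice X ξ η m⟫_ℂ = ⟪t.tmul ξ h, X (t.tmul m η)⟫_ℂ := by
  simp [TensorPair.slice, adjoint_inner_right, TensorPair.L_apply]

lemma TensorPair.adj_tmul [CompleteSpace F] [CompleteSpace EF] (t : TensorPair E F EF)
    (ξ m : E) (k : F) : adjoint (t.L ξ) (t.tmul m k) = ⟪ξ, m⟫_ℂ • k := by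
  refine ext_inner_left ℂ fun c => ?_
  rw [adjoint_inner_right, t.L_apply, t.inner_tmul, inner_smul_right]

lemma slicesR_eq [CompleteSpace F] [CompleteSpace EF] {FE : Type*}
    [NormedAddCommGroup FE] [InnerProductSpace ℂ FE]
    (t : TensorPair E F EF) (t' : TensorPair F E FE) (Sg : EF →L[ℂ] FE)
    (hSg : ∀ a b, Sg (t.tmul a b) = t'.tmul b a) (X : EF →L[ℂ] EF) :
    slicesR t t' (Sg.comp X) = {T | ∃ ξ η, T = t.slice X ξ η} := by
  have hfl : ∀ (h : F) (ξ : E) (z : EF), ⟪t'.tmul h ξ, Sg z⟫_ℂ = ⟪t.tmul ξ h, z⟫_ℂ := by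
    intro h ξ z
    have : (innerSL ℂ (t'.tmul h ξ)) ∘L Sg = innerSL ℂ (t.tmul ξ h) := by
      apply t.ext_clm_s11
      intro a b
      simp only [comp_apply, innerSL_apply_apply, hSg, t.inner_tmul, t'.inner_tmul]
      ring
    simpa using congrArg (fun f => f z) this
  ext T
  simp only [slicesR, Set.mem_setOf_eq, comp_apply, hfl]
  constructor
  · rintro ⟨ξ, η, h⟩
    refine ⟨ξ, η, ?_⟩
    ext m
    refine ext_inner_left ℂ fun c => ?_
    rw [h, t.inner_slice]
  · rintro ⟨ξ, η, rfl⟩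
    exact ⟨ξ, η, fun c m => t.inner_slice X ξ η c m⟩

lemma exists_J [CompleteSpace EFG] (t : TensorPair E F EF) (t3 : TensorTriple E F G EFG) :
    ∃ J : G →L[ℂ] EF →L[ℂ] EFG, ∀ a b c, J c (t.tmul a b) = t3.tmul a b c := by
  have h : ∀ c : G, ∃ j : EF →L[ℂ] EFG, ∀ a b, j (t.tmul a b) = t3.tmul a b c := by
    intro c
    obtain ⟨j, hj⟩ := t.exists_ext
      (LinearMap.mk₂ ℂ (fun a b => t3.tmul a b c) (by simp) (by simp) (by simp) (by simp)) ‖c‖ (by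
        intro a b a' b'
        simp only [LinearMap.mk₂_apply, t3.inner_tmul]
        rw [inner_self_eq_norm_sq_to_K]
        simp only [Complex.coe_algebraMap]
        ring)
    exact ⟨j, by simpa using hj⟩
  choose j hj using h
  have hin : ∀ c d x y, ⟪j c x, j d y⟫_ℂ = ⟪x, y⟫_ℂ * ⟪c, d⟫_ℂ := by
    intro c d x y
    have e1 : ∀ a b, ⟪t3.tmul a b c, j d y⟫_ℂ = ⟪t.tmul a b, y⟫_ℂ * ⟪c, d⟫_ℂ := by
      intro a b
      have : (innerSL ℂ (t3.tmul a b c)) ∘L j d = ⟪c, d⟫_ℂ • innerSL ℂ (t.tmul a b) := by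
        apply t.ext_clm_s11
        intro a' b'
        simp only [comp_apply, innerSL_apply_apply, hj, t3.inner_tmul, smul_apply, t.inner_tmul,
          smul_eq_mul]
        ring
      have := congrArg (fun f => f y) this
      simp only [comp_apply, innerSL_apply_apply, smul_apply, smul_eq_mul] at this
      rw [this, mul_comm]
    have : (innerSL ℂ (j d y)) ∘L j c = ⟪d, c⟫_ℂ • innerSL ℂ y := by
      apply t.ext_clm_s11
      intro a' b'
      simp only [comp_apply, innerSL_apply_apply, hj, smul_apply, smul_eq_mul]
      rw [← inner_conj_symm, e1, map_mul, inner_conj_symm, inner_conj_symm, mul_comm]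
    have := congrArg (fun f => f x) this
    simp only [comp_apply, innerSL_apply_apply, smul_apply, smul_eq_mul] at this
    rw [← inner_conj_symm, this, map_mul, inner_conj_symm, inner_conj_symm, mul_comm]
  have hadd : ∀ c d, j (c + d) = j c + j d := by
    intro c d
    apply t.ext_clm_s11
    simp [hj]
  have hsm : ∀ (r : ℂ) c, j (r • c) = r • j c := by
    intro c d
    apply t.ext_clm_s11
    simp [hj]
  refine ⟨LinearMap.mkContinuous₂ (LinearMap.mk₂ ℂ (fun c x => j c x) (by simp [hadd])
    (by simp [hsm]) (by simp) (by simp)) 1 ?_, ?_⟩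
  · intro c x
    have h := hin c c x x
    simp only [inner_self_eq_norm_sq_to_K] at h
    have h2 : ‖j c x‖ ^ 2 = (‖c‖ * ‖x‖) ^ 2 := by
      rw [mul_pow, mul_comm]
      exact_mod_cast h
    simp only [LinearMap.mk₂_apply, one_mul]
    exact ((pow_left_inj₀ (norm_nonneg _) (by positivity) two_ne_zero).1 h2).le
  · intro a b c
    simp [hj]

lemma exists_I [CompleteSpace EFG] {FG : Type*}
    [NormedAddCommGroup FG] [InnerProductSpace ℂ FG]
    (t : TensorPair F G FG) (t3 : TensorTriple E F G EFG) (m : E) :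
    ∃ j : FG →L[ℂ] EFG, ∀ b c, j (t.tmul b c) = t3.tmul m b c := by
  obtain ⟨j, hj⟩ := t.exists_ext (t3.tmul m) ‖m‖ (by
        intro a b a' b'
        simp only [t3.inner_tmul]
        rw [inner_self_eq_norm_sq_to_K]
        simp only [Complex.coe_algebraMap]
        ring)
  exact ⟨j, hj⟩

end Helpers

section Core

variable {H H2 M MH MHH : Type*}
    [NormedAddCommGroup H] [InnerProductSpace ℂ H] [CompleteSpace H]
    [NormedAddCommGroup H2] [InnerProductSpace ℂ H2] [CompleteSpace H2]
    [NormedAddCommGroup M] [InnerProductSpace ℂ M] [CompleteSpace M]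
    [NormedAddCommGroup MH] [InnerProductSpace ℂ MH] [CompleteSpace MH]
    [NormedAddCommGroup MHH] [InnerProductSpace ℂ MHH] [CompleteSpace MHH]

/-- The two descriptions of the twisted slice map. -/
lemma exists_theta (t2 : TensorPair H H H2) (W : H2 →L[ℂ] H2)
    (tMH : TensorPair M H MH) (tMHH : TensorTriple M H H MHH)
    (U : MH →L[ℂ] MH) (hUu : star U * U = 1)
    (U12 U13 W23m : MHH →L[ℂ] MHH)
    (hU12 : IsLeg12 tMH tMHH U U12) (hU13 : IsLeg13 tMH tMHH U U13)
    (hW23m : IsLeg23 t2 tMHH W W23m)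
    (hcorep : W23m * U12 = U12 * U13 * W23m) (b η : H) :
    ∃ Θ : MH → (M →L[ℂ] H), Continuous Θ ∧ (∀ x y, Θ (x + y) = Θ x + Θ y) ∧
      (∀ (c : ℂ) x, Θ (c • x) = (starRingEnd ℂ) c • Θ x) ∧
      (∀ ξ h, Θ (tMH.tmul ξ h) = t2.slice W h η ∘L adjoint (tMH.L ξ) ∘L U ∘L tMH.L.flip b) ∧
      (∀ ξ h, Θ (U (tMH.tmul ξ h)) = tMH.slice U ξ (t2.slice W h η b)) := by
  obtain ⟨J, hJ⟩ := exists_J tMH tMHH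
  have hUi : ∀ x y, ⟪U x, U y⟫_ℂ = ⟪x, y⟫_ℂ := by
    intro x y
    have : adjoint U (U y) = y := congrArg (fun f => f y) hUu
    rw [← adjoint_inner_right, this]
  have hJin : ∀ a h c d z, ⟪tMHH.tmul a h c, J d z⟫_ℂ = ⟪tMH.tmul a h, z⟫_ℂ * ⟪c, d⟫_ℂ := by
    intro a h c d z
    have : (innerSL ℂ (tMHH.tmul a h c)) ∘L J d = ⟪c, d⟫_ℂ • innerSL ℂ (tMH.tmul a h) := by
      apply tMH.ext_clm_s11
      intro a' b'
      simp only [comp_apply, innerSL_apply_apply, hJ, tMHH.inner_tmul, smul_apply,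
        tMH.inner_tmul, smul_eq_mul]
      ring
    have := congrArg (fun f => f z) this
    simp only [comp_apply, innerSL_apply_apply, smul_apply, smul_eq_mul] at this
    rw [this, mul_comm]
  have hJin2 : ∀ c d x z, ⟪J c x, J d z⟫_ℂ = ⟪x, z⟫_ℂ * ⟪c, d⟫_ℂ := by
    intro c d x z
    have : (innerSL ℂ (J d z)) ∘L J c = ⟪d, c⟫_ℂ • innerSL ℂ z := by
      apply tMH.ext_clm_s11
      intro a' b'
      simp only [comp_apply, innerSL_apply_apply, hJ, smul_apply, smul_eq_mul]
      rw [← inner_conj_symm, hJin, map_mul, inner_conj_symm, inner_conj_symm, mul_comm]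
    have := congrArg (fun f => f x) this
    simp only [comp_apply, innerSL_apply_apply, smul_apply, smul_eq_mul] at this
    rw [← inner_conj_symm, this, map_mul, inner_conj_symm, inner_conj_symm, mul_comm]
  have hU12J : ∀ m k c, U12 (tMHH.tmul m k c) = J c (U (tMH.tmul m k)) := by
    intro m k c
    apply tMHH.ext_inner
    intro a h d
    rw [hU12, hJin]
  have hU12i : ∀ m k c y, ⟪U12 (tMHH.tmul m k c), U12 y⟫_ℂ = ⟪tMHH.tmul m k c, y⟫_ℂ := by
    intro m k c y
    have : (innerSL ℂ (U12 (tMHH.tmul m k c))) ∘L U12 = innerSL ℂ (tMHH.tmul m k c) := by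
      apply tMHH.ext_clm_s11
      intro m' k' c'
      simp only [comp_apply, innerSL_apply_apply, hU12J, hJin2, hUi, tMHH.inner_tmul,
        tMH.inner_tmul]
    simpa using congrArg (fun f => f y) this
  refine ⟨fun v => adjoint (J.flip v) ∘L (W23m ∘L J η ∘L U ∘L tMH.L.flip b), ?_, ?_, ?_, ?_, ?_⟩
  · have h1 : Continuous fun v => adjoint (J.flip v) :=
      (LinearIsometryEquiv.continuous _).comp J.flip.continuous
    exact h1.clm_comp continuous_const
  · intro x y
    simp [add_comp]
  · intro c x
    have : adjoint (J.flip (c • x)) = (starRingEnd ℂ) c • adjoint (J.flip x) := by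
      rw [map_smul, map_smulₛₗ]
    simp only [this, smul_comp]
  · intro ξ h
    have hw : adjoint (J.flip (tMH.tmul ξ h)) ∘L W23m ∘L J η
        = t2.slice W h η ∘L adjoint (tMH.L ξ) := by
      apply tMH.ext_clm_s11
      intro m k
      refine ext_inner_left ℂ fun c => ?_
      simp only [comp_apply]
      rw [adjoint_inner_right, flip_apply, hJ, hJ, hW23m, tMH.adj_tmul, map_smul,
        inner_smul_right, t2.inner_slice, mul_comm]
    calc _ = (adjoint (J.flip (tMH.tmul ξ h)) ∘L W23m ∘L J η) ∘L U ∘L tMH.L.flip b := rfl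
      _ = _ := by rw [hw]; rfl
  · intro ξ h
    ext m
    refine ext_inner_left ℂ fun c => ?_
    simp only [comp_apply]
    obtain ⟨I, hI⟩ := exists_I t2 tMHH m
    have hWI : ∀ k c, W23m (tMHH.tmul m k c) = I (W (t2.tmul k c)) := by
      intro k c
      apply tMHH.ext_inner
      intro a h d
      rw [hW23m]
      have : (innerSL ℂ (tMHH.tmul a h d)) ∘L I = ⟪a, m⟫_ℂ • innerSL ℂ (t2.tmul h d) := by
        apply t2.ext_clm_s11
        intro a' b'
        simp only [comp_apply, innerSL_apply_apply, hI, tMHH.inner_tmul, smul_apply,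
          t2.inner_tmul, smul_eq_mul]
        ring
      have := congrArg (fun f => f (W (t2.tmul k c))) this
      simp only [comp_apply, innerSL_apply_apply, smul_apply, smul_eq_mul] at this
      rw [this, mul_comm]
    have hUI : ∀ z, ⟪tMHH.tmul ξ h c, U13 (I z)⟫_ℂ
        = ⟪tMH.tmul ξ c, U (tMH.tmul m (adjoint (t2.L h) z))⟫_ℂ := by
      intro z
      have : (innerSL ℂ (tMHH.tmul ξ h c)) ∘L U13 ∘L I
          = innerSL ℂ (tMH.tmul ξ c) ∘L U ∘L tMH.L m ∘L adjoint (t2.L h) := by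
        apply t2.ext_clm_s11
        intro a' b'
        simp only [comp_apply, innerSL_apply_apply, hI, t2.adj_tmul, map_smul, tMH.L_apply,
          smul_eq_mul]
        rw [hU13, mul_comm]
      simpa [tMH.L_apply] using congrArg (fun f => f z) this
    rw [adjoint_inner_right, flip_apply, flip_apply, tMH.L_apply, ← hU12J, ← hU12J,
      show W23m (U12 (tMHH.tmul m b η)) = U12 (U13 (W23m (tMHH.tmul m b η))) from
        congrArg (fun f => f (tMHH.tmul m b η)) hcorep, hU12i, hWI, hUI, tMH.inner_slice]
    simp [TensorPair.slice, t2.L_apply]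

end Core

/-- For a regular multiplicative unitary `W` on `H` and a
corepresentation `U` of `W` on `M`, the closed span of the slices
`(id ⊗ ω_{ξ,η})(Σ_{M,H} U)` equals `K(M, H)`. -/
theorem statement11
    {H H2 H3 : Type*}
    [NormedAddCommGroup H] [InnerProductSpace ℂ H] [CompleteSpace H]
    [NormedAddCommGroup H2] [InnerProductSpace ℂ H2] [CompleteSpace H2]
    [NormedAddCommGroup H3] [InnerProductSpace ℂ H3] [CompleteSpace H3]
    -- realizations of the tensor products H ⊗ H and H ⊗ H ⊗ H
    (t2 : TensorPair H H H2) (t3 : TensorTriple H H H H3)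
    -- W is a unitary on H ⊗ H
    (W : H2 →L[ℂ] H2) (hWu : star W * W = 1 ∧ W * star W = 1)
    -- the legs W₁₂, W₂₃, W₁₃ of W on H ⊗ H ⊗ H
    (W12 W23 W13 : H3 →L[ℂ] H3)
    (hW12 : IsLeg12 t2 t3 W W12) (hW23 : IsLeg23 t2 t3 W W23)
    (hW13 : IsLeg13 t2 t3 W W13)
    -- the pentagon equation W₂₃W₁₂ = W₁₂W₁₃W₂₃
    (hpent : W23 * W12 = W12 * W13 * W23)
    -- the tensor flip Σ on H ⊗ H
    (Sg : H2 →L[ℂ] H2) (hSg : ∀ a b : H, Sg (t2.tmul a b) = t2.tmul b a)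
    -- regularity: C(W) = K(H)
    (hreg : hatA t2 (Sg * W) = {T : H →L[ℂ] H | IsCompactOperator T})
    -- U is a unitary corepresentation of W on M
    {M MH HM MHH : Type*}
    [NormedAddCommGroup M] [InnerProductSpace ℂ M] [CompleteSpace M]
    [NormedAddCommGroup MH] [InnerProductSpace ℂ MH] [CompleteSpace MH]
    [NormedAddCommGroup HM] [InnerProductSpace ℂ HM] [CompleteSpace HM]
    [NormedAddCommGroup MHH] [InnerProductSpace ℂ MHH] [CompleteSpace MHH]
    (tMH : TensorPair M H MH) (tHM : TensorPair H M HM)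
    (tMHH : TensorTriple M H H MHH)
    (U : MH →L[ℂ] MH) (hUu : star U * U = 1 ∧ U * star U = 1)
    (U12 U13 W23m : MHH →L[ℂ] MHH)
    (hU12 : IsLeg12 tMH tMHH U U12) (hU13 : IsLeg13 tMH tMHH U U13)
    (hW23m : IsLeg23 t2 tMHH W W23m)
    -- the corepresentation condition W₂₃U₁₂ = U₁₂U₁₃W₂₃ on M ⊗ H ⊗ H
    (hcorep : W23m * U12 = U12 * U13 * W23m)
    -- the tensor flip Σ_{M,H} : M ⊗ H → H ⊗ M
    (SgMH : MH →L[ℂ] HM) (hSgMH : ∀ (m : M) (h : H), SgMH (tMH.tmul m h) = tHM.tmul h m) :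
    cspan (slicesR tMH tHM (SgMH.comp U)) = {T : M →L[ℂ] H | IsCompactOperator T} := by
  have hS1 : slicesR tMH tHM (SgMH.comp U) = {T | ∃ ξ η, T = tMH.slice U ξ η} :=
    slicesR_eq tMH tHM SgMH hSgMH U
  have hS2 : slicesR t2 t2 (Sg * W) = {T | ∃ ξ η, T = t2.slice W ξ η} :=
    slicesR_eq t2 t2 Sg hSg W
  rw [hS1]
  rw [hatA, hS2] at hreg
  rcases subsingleton_or_nontrivial H with hH | hH
  · have : Subsingleton (M →L[ℂ] H) := ⟨fun f g => by ext x; exact Subsingleton.elim _ _⟩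
    have h0 : IsCompactOperator (0 : M →L[ℂ] H) := isCompactOperator_zero
    ext T
    rw [Subsingleton.elim T 0]
    simp only [cspan, Set.mem_setOf_eq]
    exact iff_of_true (subset_closure (Submodule.zero_mem _)) h0
  obtain ⟨b, hb⟩ := exists_norm_eq H (c := 1) zero_le_one
  have hbb : ⟪b, b⟫_ℂ = 1 := by rw [inner_self_eq_norm_sq_to_K, hb]; simp
  set S : Submodule ℂ (M →L[ℂ] H) :=
    (Submodule.span ℂ {T | ∃ ξ η, T = tMH.slice U ξ η}).topologicalClosure with hSdef
  have hScl : IsClosed (S : Set (M →L[ℂ] H)) := Submodule.isClosed_topologicalClosure _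
  have hSc : cspan {T : M →L[ℂ] H | ∃ ξ η, T = tMH.slice U ξ η} = S := rfl
  set KM : Submodule ℂ (M →L[ℂ] H) := compactOperator (RingHom.id ℂ) M H with hKM
  have hKcl : IsClosed (KM : Set (M →L[ℂ] H)) := isClosed_setOfPred_isCompactOperator
  have hKc : {T : M →L[ℂ] H | IsCompactOperator T} = KM := rfl
  -- induction principle from regularity
  have hind : ∀ (R : Submodule ℂ (M →L[ℂ] H)) (_ : IsClosed (R : Set (M →L[ℂ] H)))
      (Ψ : (H →L[ℂ] H) →L[ℂ] (M →L[ℂ] H)), (∀ h η, Ψ (t2.slice W h η) ∈ R) →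
      ∀ T : H →L[ℂ] H, IsCompactOperator T → Ψ T ∈ R := by
    intro R hR Ψ hΨ T hT
    have hT' : T ∈ closure (Submodule.span ℂ {T | ∃ ξ η, T = t2.slice W ξ η} : Set (H →L[ℂ] H)) := by
      change T ∈ cspan _
      rw [hreg]; exact hT
    have hcl : IsClosed (Ψ ⁻¹' (R : Set (M →L[ℂ] H))) := hR.preimage Ψ.continuous
    refine (hcl.closure_subset_iff.2 ?_) hT'
    have : Submodule.span ℂ {T | ∃ ξ η, T = t2.slice W ξ η} ≤ R.comap (Ψ : (H →L[ℂ] H) →ₗ[ℂ] (M →L[ℂ] H)) := by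
      rw [Submodule.span_le]
      rintro _ ⟨h, η, rfl⟩
      exact hΨ h η
    exact fun x hx => this hx
  have hKslice : ∀ h η, IsCompactOperator (t2.slice W h η) := by
    intro h η
    have : t2.slice W h η ∈ cspan {T | ∃ ξ η, T = t2.slice W ξ η} :=
      subset_closure (Submodule.subset_span ⟨h, η, rfl⟩)
    rw [hreg] at this
    exact this
  have hTh := fun η => exists_theta t2 W tMH tMHH U hUu.1 U12 U13 W23m hU12 hU13 hW23m hcorep b η
  rw [hSc, hKc]
  apply Set.Subset.antisymm
  · have hle : S ≤ KM := by
      refine Submodule.topologicalClosure_minimal _ ?_ hKcl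
      rw [Submodule.span_le]
      rintro _ ⟨ξ, a, rfl⟩
      let Ψ : (H →L[ℂ] H) →L[ℂ] (M →L[ℂ] H) :=
        (compL ℂ M MH H (adjoint (tMH.L ξ) ∘L U)) ∘L tMH.L.flip ∘L
          (ContinuousLinearMap.apply ℂ H b)
      have hΨ : ∀ T, Ψ T = tMH.slice U ξ (T b) := fun T => rfl
      have := hind KM hKcl Ψ (by
        intro h η
        obtain ⟨Θ, hc, hadd, hsm, h1, h2⟩ := hTh η
        rw [hΨ, ← h2]
        refine tMH.mem_of_conj KM hKcl Θ hc hadd hsm ?_ _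
        intro ξ' h'
        rw [h1]
        exact (hKslice h' η).comp_clm _) _ (isCompactOperator_rankOne_s11 a b)
      rw [hΨ, InnerProductSpace.rankOne_apply, hbb, one_smul] at this
      exact this
    exact hle
  · intro T hT
    refine compact_mem_of_rankOne S hScl ?_ T hT
    intro a m
    -- slices composed with the amplification
    have hs1 : ∀ η v, ∀ Θ : MH → (M →L[ℂ] H), Continuous Θ → (∀ x y, Θ (x + y) = Θ x + Θ y) →
      (∀ (c : ℂ) x, Θ (c • x) = (starRingEnd ℂ) c • Θ x) →
      (∀ ξ h, Θ (U (tMH.tmul ξ h)) = tMH.slice U ξ (t2.slice W h η b)) → Θ v ∈ S := by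
      intro η v Θ hc hadd hsm h2
      have hv : v = U (adjoint U v) := (congrArg (fun f => f v) hUu.2).symm
      rw [hv]
      refine tMH.mem_of_conj S hScl (fun x => Θ (U x)) (hc.comp U.continuous)
        (by simp [hadd]) (by simp [hsm]) ?_ _
      intro ξ h
      rw [h2]
      exact subset_closure (Submodule.subset_span ⟨_, _, rfl⟩)
    have hs2 : ∀ ξ h, InnerProductSpace.rankOne ℂ a h ∘L adjoint (tMH.L ξ) ∘L U ∘L tMH.L.flip b
        ∈ S := by
      intro ξ h
      refine hind S hScl ((compL ℂ M H H).flip (adjoint (tMH.L ξ) ∘L U ∘L tMH.L.flip b)) ?_ _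
        (isCompactOperator_rankOne_s11 a h)
      intro h' η
      obtain ⟨Θ, hc, hadd, hsm, h1, h2⟩ := hTh η
      have := hs1 η (tMH.tmul ξ h') Θ hc hadd hsm h2
      rw [h1] at this
      exact this
    have hs3 : ∀ v : MH, InnerProductSpace.rankOne ℂ a v ∘L U ∘L tMH.L.flip b ∈ S := by
      intro v
      refine tMH.mem_of_conj S hScl
        (fun v => InnerProductSpace.rankOne ℂ a v ∘L U ∘L tMH.L.flip b)
        ((InnerProductSpace.rankOne ℂ a).continuous.clm_comp continuous_const)
        (by simp [add_comp]) (by simp [smul_comp]) ?_ v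
      intro ξ h
      convert hs2 ξ h using 1
      ext x
      simp only [comp_apply, InnerProductSpace.rankOne_apply, adjoint_inner_right, tMH.L_apply]
    convert hs3 (U (tMH.tmul m b)) using 1
    ext x
    have : adjoint U (U (tMH.tmul x b)) = tMH.tmul x b :=
      congrArg (fun f => f (tMH.tmul x b)) hUu.1
    simp only [comp_apply, InnerProductSpace.rankOne_apply, flip_apply, tMH.L_apply]
    rw [← adjoint_inner_right, this, tMH.inner_tmul, hbb, mul_one]

end
end

section
/- Let W be a multiplicative unitary on a complex Hilbert space H admitting a nonzero fixed vector e ∈ H, i.e. e ≠ 0 and W(e ⊗ ζ) = e ⊗ ζ for all ζ ∈ H. Then every representation of W also fixes e: if V is a unitary on H ⊗ N with V₂₃W₁₂ = W₁₂V₁₃V₂₃ on H ⊗ H ⊗ N, then V(e ⊗ ξ) = e ⊗ ξ for all ξ ∈ N. -/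
/-!
Common framework: we axiomatize realizations of Hilbert-space tensor products.
A `TensorPair E F EF` realizes the Hilbert tensor product `E ⊗ F` as the Hilbert
space `EF`: it consists of a bilinear map `(a, b) ↦ a ⊗ b` whose image satisfies
the characteristic inner-product identity and has total (dense) linear span.
Operators such as the leg operators `X₁₂`, `X₂₃`, `X₁₃`, amplifications `a ⊗ b`,
and the tensor flip `Σ` are then uniquely characterized by their matrix
coefficients against elementary tensors.
-/

noncomputable section

open scoped InnerProductSpace
open ContinuousLinearMap

theorem TensorPair.opext {E F EF K : Type*}
    [NormedAddCommGroup E] [InnerProductSpace ℂ E]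
    [NormedAddCommGroup F] [InnerProductSpace ℂ F]
    [NormedAddCommGroup EF] [InnerProductSpace ℂ EF]
    [NormedAddCommGroup K] [NormedSpace ℂ K]
    (t : TensorPair E F EF) {S T : EF →L[ℂ] K}
    (h : ∀ a b, S (t.tmul a b) = T (t.tmul a b)) : S = T := by
  refine ContinuousLinearMap.ext_on t.dense_span ?_
  rintro _ ⟨a, b, rfl⟩
  exact h a b

theorem TensorTriple.opext {E F G EFG K : Type*}
    [NormedAddCommGroup E] [InnerProductSpace ℂ E]
    [NormedAddCommGroup F] [InnerProductSpace ℂ F]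
    [NormedAddCommGroup G] [InnerProductSpace ℂ G]
    [NormedAddCommGroup EFG] [InnerProductSpace ℂ EFG]
    [NormedAddCommGroup K] [NormedSpace ℂ K]
    (t : TensorTriple E F G EFG) {S T : EFG →L[ℂ] K}
    (h : ∀ a b c, S (t.tmul a b c) = T (t.tmul a b c)) : S = T := by
  refine ContinuousLinearMap.ext_on t.dense_span ?_
  rintro _ ⟨a, b, c, rfl⟩
  exact h a b c

theorem TensorTriple.vext {E F G EFG : Type*}
    [NormedAddCommGroup E] [InnerProductSpace ℂ E]
    [NormedAddCommGroup F] [InnerProductSpace ℂ F]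
    [NormedAddCommGroup G] [InnerProductSpace ℂ G]
    [NormedAddCommGroup EFG] [InnerProductSpace ℂ EFG]
    (t : TensorTriple E F G EFG) {x y : EFG}
    (h : ∀ a b c, ⟪t.tmul a b c, x⟫_ℂ = ⟪t.tmul a b c, y⟫_ℂ) : x = y := by
  have : innerSL ℂ x = innerSL ℂ y := by
    refine t.opext fun a b c => ?_
    rw [innerSL_apply_apply, innerSL_apply_apply, ← inner_conj_symm, h, inner_conj_symm]
  refine ext_inner_right ℂ fun v => ?_
  simpa using congrArg (fun f => f v) this

/-- The operator `x ↦ e ⊗ x`. -/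
theorem exists_creation {E F G FG EFG : Type*}
    [NormedAddCommGroup E] [InnerProductSpace ℂ E]
    [NormedAddCommGroup F] [InnerProductSpace ℂ F]
    [NormedAddCommGroup G] [InnerProductSpace ℂ G]
    [NormedAddCommGroup FG] [InnerProductSpace ℂ FG]
    [NormedAddCommGroup EFG] [InnerProductSpace ℂ EFG] [CompleteSpace EFG]
    (t : TensorPair F G FG) (t3 : TensorTriple E F G EFG) (e : E) :
    ∃ L : FG →L[ℂ] EFG, ∀ b c, L (t.tmul b c) = t3.tmul e b c := by
  let p : TensorProduct ℂ F G →ₗ[ℂ] FG := TensorProduct.lift t.tmul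
  let q : TensorProduct ℂ F G →ₗ[ℂ] EFG := TensorProduct.lift (t3.tmul e)
  have hd : DenseRange p := by
    refine t.dense_span.mono ?_
    have : Submodule.span ℂ {z : FG | ∃ a b, z = t.tmul a b} ≤ LinearMap.range p := by
      rw [Submodule.span_le]
      rintro _ ⟨a, b, rfl⟩
      exact ⟨TensorProduct.tmul ℂ a b, by simp [p]⟩
    exact this
  have hi : ∀ x y, ⟪q x, q y⟫_ℂ = ⟪e, e⟫_ℂ * ⟪p x, p y⟫_ℂ := by
    intro x y
    induction x using TensorProduct.induction_on with
    | zero => simp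
    | add x x' hx hx' => rw [map_add, map_add, inner_add_left, inner_add_left, hx, hx', mul_add]
    | tmul b c =>
      induction y using TensorProduct.induction_on with
      | zero => simp
      | add x x' hx hx' =>
        rw [map_add, map_add, inner_add_right, inner_add_right, hx, hx', mul_add]
      | tmul b' c' =>
        simp only [p, q, TensorProduct.lift.tmul, t.inner_tmul, t3.inner_tmul]
        ring
  have hn : ∃ C, ∀ x, ‖q x‖ ≤ C * ‖p x‖ := by
    refine ⟨‖e‖, fun x => ?_⟩
    have h := hi x x
    simp only [inner_self_eq_norm_sq_to_K] at h
    have h2 : ‖q x‖ ^ 2 = (‖e‖ * ‖p x‖) ^ 2 := by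
      rw [mul_pow]; exact_mod_cast h
    exact (pow_le_pow_iff_left₀ (by positivity) (by positivity) two_ne_zero).1 h2.le
  refine ⟨q.extendOfNorm p, fun b c => ?_⟩
  have := LinearMap.extendOfNorm_eq hd hn (TensorProduct.tmul ℂ b c)
  simpa [p, q] using this

/-- If a multiplicative unitary `W` on `H` has a nonzero fixed
vector `e`, then every representation `V` of `W` also fixes `e`:
`V(e ⊗ ξ) = e ⊗ ξ` for all `ξ ∈ N`. -/
theorem statement16
    {H H2 H3 : Type*}
    [NormedAddCommGroup H] [InnerProductSpace ℂ H] [CompleteSpace H]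
    [NormedAddCommGroup H2] [InnerProductSpace ℂ H2] [CompleteSpace H2]
    [NormedAddCommGroup H3] [InnerProductSpace ℂ H3] [CompleteSpace H3]
    -- realizations of the tensor products H ⊗ H and H ⊗ H ⊗ H
    (t2 : TensorPair H H H2) (t3 : TensorTriple H H H H3)
    -- W is a unitary on H ⊗ H
    (W : H2 →L[ℂ] H2) (hWu : star W * W = 1 ∧ W * star W = 1)
    -- the legs W₁₂, W₂₃, W₁₃ of W on H ⊗ H ⊗ H
    (W12 W23 W13 : H3 →L[ℂ] H3)
    (hW12 : IsLeg12 t2 t3 W W12) (hW23 : IsLeg23 t2 t3 W W23)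
    (hW13 : IsLeg13 t2 t3 W W13)
    -- the pentagon equation W₂₃W₁₂ = W₁₂W₁₃W₂₃
    (hpent : W23 * W12 = W12 * W13 * W23)
    -- e is a nonzero fixed vector for W
    (e : H) (he : e ≠ 0) (hfix : ∀ ζ : H, W (t2.tmul e ζ) = t2.tmul e ζ)
    -- V is a unitary representation of W on N
    {N HN NH HHN : Type*}
    [NormedAddCommGroup N] [InnerProductSpace ℂ N] [CompleteSpace N]
    [NormedAddCommGroup HN] [InnerProductSpace ℂ HN] [CompleteSpace HN]
    [NormedAddCommGroup NH] [InnerProductSpace ℂ NH] [CompleteSpace NH]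
    [NormedAddCommGroup HHN] [InnerProductSpace ℂ HHN] [CompleteSpace HHN]
    (tHN : TensorPair H N HN) (tNH : TensorPair N H NH)
    (tHHN : TensorTriple H H N HHN)
    (V : HN →L[ℂ] HN) (hVu : star V * V = 1 ∧ V * star V = 1)
    (V23 V13 W12n : HHN →L[ℂ] HHN)
    (hV23 : IsLeg23 tHN tHHN V V23) (hV13 : IsLeg13 tHN tHHN V V13)
    (hW12n : IsLeg12 t2 tHHN W W12n)
    -- the representation condition V₂₃W₁₂ = W₁₂V₁₃V₂₃ on H ⊗ H ⊗ N
    (hrep : V23 * W12n = W12n * V13 * V23)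
    :
    ∀ ξ : N, V (tHN.tmul e ξ) = tHN.tmul e ξ := by
  intro ξ
  obtain ⟨L, hL⟩ := exists_creation tHN tHHN e
  have hLi : ∀ a b c y, ⟪tHHN.tmul a b c, L y⟫_ℂ = ⟪tHN.tmul b c, y⟫_ℂ * ⟪a, e⟫_ℂ := by
    intro a b c y
    have : (innerSL ℂ (tHHN.tmul a b c)).comp L = ⟪a, e⟫_ℂ • innerSL ℂ (tHN.tmul b c) := by
      refine tHN.opext fun b' c' => ?_
      simp [hL, tHN.inner_tmul, tHHN.inner_tmul, mul_assoc]
    have h := congrArg (fun f => f y) this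
    simp at h
    rw [h, mul_comm]
  have hVL : ∀ b c, V23 (tHHN.tmul e b c) = L (V (tHN.tmul b c)) := by
    intro b c
    refine tHHN.vext fun a' b' c' => ?_
    rw [hV23, hLi]
  have hWe : ∀ b c, W12n (tHHN.tmul e b c) = tHHN.tmul e b c := by
    intro b c
    refine tHHN.vext fun a' b' c' => ?_
    rw [hW12n, hfix, t2.inner_tmul, tHHN.inner_tmul]
  have hWs : ∀ b, star W (t2.tmul e b) = t2.tmul e b := by
    intro b
    have h := congrArg (fun f => f (t2.tmul e b)) hWu.1
    simpa [hfix] using h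
  have hWi : ∀ b c y, ⟪tHHN.tmul e b c, W12n y⟫_ℂ = ⟪tHHN.tmul e b c, y⟫_ℂ := by
    intro b c y
    have : (innerSL ℂ (tHHN.tmul e b c)).comp W12n = innerSL ℂ (tHHN.tmul e b c) := by
      refine tHHN.opext fun a' b' c' => ?_
      simp only [ContinuousLinearMap.comp_apply, innerSL_apply_apply]
      rw [hW12n, ← ContinuousLinearMap.adjoint_inner_left, ← ContinuousLinearMap.star_eq_adjoint,
        hWs, t2.inner_tmul, tHHN.inner_tmul]
    simpa using congrArg (fun f => f y) this
  have hLV : L.comp V = (W12n.comp (V13.comp L)).comp V := by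
    refine tHN.opext fun b c => ?_
    have h := congrArg (fun f => f (tHHN.tmul e b c)) hrep
    simpa [hWe, hVL] using h
  have hLL : ∀ y, L y = W12n (V13 (L y)) := by
    intro y
    have h := congrArg (fun f => f (star V y)) hLV
    have h' : V (star V y) = y := by
      simpa using congrArg (fun f => f y) hVu.2
    simpa only [ContinuousLinearMap.comp_apply, h'] using h
  have hin : ⟪tHN.tmul e ξ, V (tHN.tmul e ξ)⟫_ℂ = ⟪tHN.tmul e ξ, tHN.tmul e ξ⟫_ℂ := by
    have h := hWi e ξ (V13 (L (tHN.tmul e ξ)))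
    rw [← hLL, hL, hV13, tHHN.inner_tmul] at h
    have hee : ⟪e, e⟫_ℂ ≠ 0 := inner_self_ne_zero.2 he
    apply mul_right_cancel₀ hee
    rw [← h, tHN.inner_tmul]
    ring
  have hVV : ⟪V (tHN.tmul e ξ), V (tHN.tmul e ξ)⟫_ℂ = ⟪tHN.tmul e ξ, tHN.tmul e ξ⟫_ℂ := by
    rw [← ContinuousLinearMap.adjoint_inner_left, ← ContinuousLinearMap.star_eq_adjoint]
    have h' : star V (V (tHN.tmul e ξ)) = tHN.tmul e ξ := by
      simpa using congrArg (fun f => f (tHN.tmul e ξ)) hVu.1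
    rw [h']
  have hin' : ⟪V (tHN.tmul e ξ), tHN.tmul e ξ⟫_ℂ = ⟪tHN.tmul e ξ, tHN.tmul e ξ⟫_ℂ := by
    rw [← inner_conj_symm, hin, inner_conj_symm]
  rw [← sub_eq_zero, ← inner_self_eq_zero (𝕜 := ℂ), inner_sub_left, inner_sub_right,
    inner_sub_right, hin, hVV, hin']
  ring

end
end
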